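/- Consider a quitting game in which the set of normal players I_* is nonempty, enumerated as I_* = {1,…,n}, and suppose that the linear complementarity problem LCP((r̂^i)_{i=1}^n, 0) has no nontrivial solution. If the n×n matrix R̂ whose i-th column is r̂^i is not a Q-matrix, then the quitting game has a stationary ε-equilibrium for every ε > 0. -/

import Mathlib

noncomputable section

/-- The probability that, under the behavior strategy profile `x`, the game terminates at
stage `t` (0-indexed) with quitting set `S`. -/
def termProb {N : ℕ} (x : Fin N → ℕ → ℝ) (t : ℕ) (S : Finset (Fin N)) : ℝ :=
  (∏ u ∈ Finset.range t, ∏ i : Fin N, (1 - x i u)) *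
    ((∏ i ∈ S, x i t) * ∏ i ∈ Sᶜ, (1 - x i t))

/-- The collection of nonempty subsets of players. -/
def nonempties (N : ℕ) : Finset (Finset (Fin N)) :=
  Finset.univ.filter fun S => S ≠ ∅

/-- The expected payoff of player `i` under the behavior strategy profile `x` in the
quitting game with payoffs `r`. -/
def payoff {N : ℕ} (r : Finset (Fin N) → Fin N → ℝ) (x : Fin N → ℕ → ℝ) (i : Fin N) : ℝ :=
  (∑' t : ℕ, ∑ S ∈ nonempties N, termProb x t S * r S i) +
    (1 - ∑' t : ℕ, ∑ S ∈ nonempties N, termProb x t S) * r ∅ i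

/-- `x` is an `ε`-equilibrium: it is a valid profile and no player can gain more than `ε`
by a unilateral deviation to any valid behavior strategy. -/
def IsEpsEquilibrium {N : ℕ} (r : Finset (Fin N) → Fin N → ℝ)
    (x : Fin N → ℕ → ℝ) (ε : ℝ) : Prop :=
  (∀ i t, x i t ∈ Set.Icc (0 : ℝ) 1) ∧
    ∀ (i : Fin N) (x' : ℕ → ℝ), (∀ t, x' t ∈ Set.Icc (0 : ℝ) 1) →
      payoff r x i ≥ payoff r (Function.update x i x') i - ε

/-- The decreasing sequence of sets of players `I_0 ⊇ I_1 ⊇ ⋯`: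
`I_0 = I` and `I_{l+1} = {i ∈ I_l : ∃ j ∈ I_l, j ≠ i, r^j_i ≤ 0}`. -/
def normalLevel {N : ℕ} (r : Finset (Fin N) → Fin N → ℝ) : ℕ → Set (Fin N)
  | 0 => Set.univ
  | l + 1 => {i | i ∈ normalLevel r l ∧ ∃ j ∈ normalLevel r l, j ≠ i ∧ r {j} i ≤ 0}

/-- The set `I_* = ∩_l I_l` of normal players. -/
def normalPlayers {N : ℕ} (r : Finset (Fin N) → Fin N → ℝ) : Set (Fin N) :=
  ⋂ l, normalLevel r l

/-- A solution `(w,z)` of the linear complementarity problem `LCP((r^i)_{i=1}^n, q)`,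
where `r i` is the vector `r^i`: `w ∈ ℝ^n_{≥0}`, `z ∈ Δ({0,1,…,n})`,
`w = z_0 q + ∑_i z_i r^i`, and `z_i = 0` or `w_i = 0` for every `i ∈ [n]`. -/
def IsLCPSolution (n : ℕ) (r : Fin n → Fin n → ℝ) (q w : Fin n → ℝ)
    (z : Fin (n + 1) → ℝ) : Prop :=
  (∀ i, 0 ≤ w i) ∧ (∀ i, 0 ≤ z i) ∧ (∑ i, z i = 1) ∧
    (∀ j, w j = z 0 * q j + ∑ i : Fin n, z i.succ * r i j) ∧
    (∀ i : Fin n, z i.succ = 0 ∨ w i = 0)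

/-- The matrix with columns `r^1,…,r^n` is a `Q`-matrix if `LCP((r^i), q)` has a solution
for every `q ∈ ℝ^n`. -/
def IsQMatrix (n : ℕ) (r : Fin n → Fin n → ℝ) : Prop :=
  ∀ q : Fin n → ℝ, ∃ (w : Fin n → ℝ) (z : Fin (n + 1) → ℝ), IsLCPSolution n r q w z



section Scarf

variable {A ι β : Type*} [Fintype A] [DecidableEq A] [Fintype ι] [DecidableEq ι] [LinearOrder β]

/-- Scarf dominance. -/
def ScarfDom (v : ι → A → β) (P : Finset A) : Prop := ∀ y, ∃ i, ∀ a ∈ P, v i y ≤ v i a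

/-- `x` is the `i`-maximal element above all the minima `m k`, `k ≠ i`. -/
def ScarfTop (v : ι → A → β) (m : ι → A) (i : ι) (x : A) : Prop :=
  (∀ k, k ≠ i → v k (m k) < v k x) ∧
    ∀ y, (∀ k, k ≠ i → v k (m k) < v k y) → v i y ≤ v i x

lemma scarf_door (v : ι → A → β) (hv : ∀ i, Function.Injective (v i)) (τ : Finset A)
    (hne : τ.Nonempty) (hD : ScarfDom v τ) (hc : τ.card + 1 = Fintype.card ι) :
    ∃ m : ι → A, (∀ i, m i ∈ τ) ∧ (∀ i, ∀ t ∈ τ, v i (m i) ≤ v i t) ∧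
      ∃ a b : ι, a ≠ b ∧ m a = m b ∧
        (∀ x, (x ∉ τ ∧ ScarfDom v (insert x τ)) ↔ (ScarfTop v m a x ∨ ScarfTop v m b x)) ∧
        (∀ x, ¬ (ScarfTop v m a x ∧ ScarfTop v m b x)) := by
  have h1 : ∀ i, ∃ x ∈ τ, ∀ t ∈ τ, v i x ≤ v i t := fun i => Finset.exists_min_image τ (v i) hne
  choose m hm hmin using h1
  have hminE : ∀ i s, s ∈ τ → (∀ t ∈ τ, v i s ≤ v i t) → m i = s := fun i s hs h =>
    hv i (le_antisymm (hmin i s hs) (h _ (hm i)))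
  have hsurj : ∀ s ∈ τ, ∃ i, m i = s := by
    intro s hs
    obtain ⟨i, hi⟩ := hD s
    exact ⟨i, hminE i s hs hi⟩
  obtain ⟨a, -, b, -, hab, hmab⟩ : ∃ x ∈ (Finset.univ : Finset ι), ∃ y ∈ (Finset.univ : Finset ι),
      x ≠ y ∧ m x = m y := by
    apply Finset.exists_ne_map_eq_of_card_lt_of_maps_to (t := τ)
    · rw [Finset.card_univ]; omega
    · intro x _; exact hm x
  refine ⟨m, hm, hmin, a, b, hab, hmab, ?_⟩
  -- surjectivity away from a or b
  have hs2 : ∀ i, i = a ∨ i = b → ∀ s ∈ τ, ∃ k, k ≠ i ∧ m k = s := by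
    intro i hi s hs
    obtain ⟨k, hk⟩ := hsurj s hs
    by_cases hki : k = i
    · subst hki
      rcases hi with rfl | rfl
      · exact ⟨b, hab.symm, hmab ▸ hk⟩
      · exact ⟨a, hab, hmab ▸ hk⟩
    · exact ⟨k, hki, hk⟩
  have hinj : ∀ i, i = a ∨ i = b → ∀ k k', k ≠ i → k' ≠ i → m k = m k' → k = k' := by
    intro i hi k k' hk hk' h
    have him : (Finset.univ.erase i).image m = τ := by
      apply Finset.Subset.antisymm
      · intro s hs
        obtain ⟨k, -, rfl⟩ := Finset.mem_image.1 hs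
        exact hm k
      · intro s hs
        obtain ⟨k, hk, hks⟩ := hs2 i hi s hs
        exact Finset.mem_image.2 ⟨k, by simp [hk], hks⟩
    have hcard : ((Finset.univ.erase i).image m).card = (Finset.univ.erase i).card := by
      rw [him, Finset.card_erase_of_mem (Finset.mem_univ _), Finset.card_univ]; omega
    exact Finset.injOn_of_card_image_eq hcard (by simp [hk]) (by simp [hk']) h
  have hK : ∀ i, (∀ s ∈ τ, ∃ k, k ≠ i ∧ m k = s) → i = a ∨ i = b := by
    intro i h
    by_contra hcon
    push Not at hcon
    obtain ⟨k, hki, hk⟩ := h (m i) (hm i)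
    by_cases hka : k = a
    · subst hka
      exact hcon.2 (hinj k (Or.inl rfl) i b hcon.1 hab.symm (hk.symm.trans hmab))
    · exact hki (hinj a (Or.inl rfl) k i hka hcon.1 hk)
  have hTopLe : ∀ i x, ScarfTop v m i x → ∀ t ∈ τ, v i x ≤ v i t := by
    intro i x hx t ht
    obtain ⟨k, hk⟩ := hD x
    by_cases hki : k = i
    · subst hki; exact hk t ht
    · exact absurd (hk (m k) (hm k)) (not_le.2 (hx.1 k hki))
  refine ⟨?_, ?_⟩
  · intro x
    constructor
    · rintro ⟨hx, hDx⟩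
      obtain ⟨i, hi⟩ := hDx x
      have hi' : ∀ s ∈ τ, ∃ k, k ≠ i ∧ m k = s ∧ v k s ≤ v k x := by
        intro s hs
        obtain ⟨k, hk⟩ := hDx s
        refine ⟨k, ?_, ?_, hk x (Finset.mem_insert_self _ _)⟩
        · rintro rfl
          have := hv k (le_antisymm (hk x (Finset.mem_insert_self _ _))
            (hi s (Finset.mem_insert_of_mem hs)))
          exact hx (this ▸ hs)
        · exact hminE k s hs (fun t ht => hk t (Finset.mem_insert_of_mem ht))
      have hiab : i = a ∨ i = b := hK i (fun s hs => by
        obtain ⟨k, h1, h2, -⟩ := hi' s hs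
        exact ⟨k, h1, h2⟩)
      have hT : ScarfTop v m i x := by
        refine ⟨?_, ?_⟩
        · intro k hk
          obtain ⟨k', h1, h2, h3⟩ := hi' (m k) (hm k)
          have := hinj i hiab k' k h1 hk h2
          subst this
          refine lt_of_le_of_ne h3 (fun h => hx ?_)
          rw [← hv _ h]; exact hm _
        · intro y hy
          obtain ⟨k, hk⟩ := hDx y
          by_cases hki : k = i
          · subst hki; exact hk x (Finset.mem_insert_self _ _)
          · exact absurd (hk (m k) (Finset.mem_insert_of_mem (hm k))) (not_le.2 (hy k hki))
      rcases hiab with rfl | rfl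
      · exact Or.inl hT
      · exact Or.inr hT
    · intro h
      obtain ⟨i, hiab, hT⟩ : ∃ i, (i = a ∨ i = b) ∧ ScarfTop v m i x := by
        rcases h with h | h
        · exact ⟨a, Or.inl rfl, h⟩
        · exact ⟨b, Or.inr rfl, h⟩
      refine ⟨?_, ?_⟩
      · intro hx
        obtain ⟨k, hk, hkx⟩ := hs2 i hiab x hx
        have := hT.1 k hk
        rw [hkx] at this
        exact lt_irrefl _ this
      · intro y
        by_cases hy : ∀ k, k ≠ i → v k (m k) < v k y
        · refine ⟨i, fun t ht => ?_⟩
          rcases Finset.mem_insert.1 ht with rfl | ht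
          · exact hT.2 y hy
          · exact (hT.2 y hy).trans (hTopLe i x hT t ht)
        · push Not at hy
          obtain ⟨k, hk, hky⟩ := hy
          refine ⟨k, fun t ht => ?_⟩
          rcases Finset.mem_insert.1 ht with rfl | ht
          · exact hky.trans (hT.1 k hk).le
          · exact hky.trans (hmin k t ht)
  · rintro x ⟨ha, hb⟩
    exact absurd (hTopLe a x ha (m a) (hm a)) (not_le.2 (hb.1 a hab))

lemma scarfTop_unique (v : ι → A → β) (hv : ∀ i, Function.Injective (v i)) (m : ι → A) (i : ι)
    (x y : A) (hx : ScarfTop v m i x) (hy : ScarfTop v m i y) : x = y :=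
  hv i (le_antisymm (hy.2 x hx.1) (hx.2 y hy.1))

lemma scarfTop_exists (v : ι → A → β) (m : ι → A) (i : ι)
    (y : A) (hy : ∀ k, k ≠ i → v k (m k) < v k y) : ∃ x, ScarfTop v m i x := by
  classical
  obtain ⟨x, hx, hmax⟩ := Finset.exists_max_image
    (Finset.univ.filter fun y => ∀ k, k ≠ i → v k (m k) < v k y) (v i) ⟨y, by simpa using hy⟩
  refine ⟨x, by simpa using hx, fun z hz => hmax z (by simpa using hz)⟩

open Classical in
lemma scarf_count (v : ι → A → β) (hv : ∀ i, Function.Injective (v i)) (s : ι → A)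
    (hs : Function.Injective s)
    (hs1 : ∀ i a, v i (s i) ≤ v i a)
    (hs2 : ∀ i k a, k ≠ i → a ∉ Set.range s → v i a < v i (s k))
    (τ : Finset A) (hne : τ.Nonempty) (hD : ScarfDom v τ) (hc : τ.card + 1 = Fintype.card ι) :
    ((∃ t ∈ τ, t ∉ Set.range s) →
      (Finset.univ.filter fun x => x ∉ τ ∧ ScarfDom v (insert x τ)).card = 2) ∧
    (∀ i0, τ = (Finset.univ.erase i0).image s →
      (Finset.univ.filter fun x => x ∉ τ ∧ ScarfDom v (insert x τ)).card = 1) := by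
  obtain ⟨m, hm, hmin, a, b, hab, hmab, hiff, hdis⟩ := scarf_door v hv τ hne hD hc
  refine ⟨?_, ?_⟩
  · rintro ⟨t, ht, htr⟩
    have hY : ∀ i, ∀ k, k ≠ i → v k (m k) < v k (s i) := fun i k hk =>
      lt_of_le_of_lt (hmin k t ht) (hs2 k i t hk.symm htr)
    obtain ⟨x, hx⟩ := scarfTop_exists v m a (s a) (hY a)
    obtain ⟨y, hy⟩ := scarfTop_exists v m b (s b) (hY b)
    rw [Finset.card_eq_two]
    refine ⟨x, y, ?_, ?_⟩
    · rintro rfl; exact hdis x ⟨hx, hy⟩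
    · ext z
      simp only [Finset.mem_filter, Finset.mem_univ, true_and, hiff, Finset.mem_insert,
        Finset.mem_singleton]
      constructor
      · rintro (h | h)
        · exact Or.inl (scarfTop_unique v hv m a _ _ h hx)
        · exact Or.inr (scarfTop_unique v hv m b _ _ h hy)
      · rintro (rfl | rfl)
        · exact Or.inl hx
        · exact Or.inr hy
  · intro i0 hτ
    have hmk : ∀ k, k ≠ i0 → m k = s k := by
      intro k hk
      exact hv k (le_antisymm (hmin k _ (by rw [hτ]; exact Finset.mem_image.2 ⟨k, by simp [hk], rfl⟩))
        (hs1 k _))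
    have hY0 : ∀ k, k ≠ i0 → v k (m k) < v k (s i0) := by
      intro k hk
      rw [hmk k hk]
      exact lt_of_le_of_ne (hs1 k _) (fun h => hk (hs (hv k h)))
    have hYb : ∀ b', b' ≠ i0 → m i0 = m b' → ∀ x, ¬ ScarfTop v m b' x := by
      intro b' hb' hmb x hx
      rw [hmk b' hb'] at hmb
      have h0 := hx.1 i0 hb'.symm
      rw [hmb] at h0
      by_cases hxr : x ∈ Set.range s
      · obtain ⟨k, rfl⟩ := hxr
        by_cases hk0 : k = i0
        · subst hk0
          exact absurd (hs1 k (s b')) (not_le.2 h0)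
        · by_cases hkb : k = b'
          · subst hkb; exact lt_irrefl _ h0
          · have := hx.1 k hkb
            rw [hmk k hk0] at this
            exact lt_irrefl _ this
      · exact absurd (hs2 i0 b' x hb' hxr) (not_lt.2 h0.le)
    obtain ⟨x, hx⟩ := scarfTop_exists v m i0 (s i0) hY0
    rw [Finset.card_eq_one]
    refine ⟨x, ?_⟩
    ext z
    simp only [Finset.mem_filter, Finset.mem_univ, true_and, hiff, Finset.mem_singleton]
    by_cases ha : a = i0
    · subst ha
      constructor
      · rintro (h | h)
        · exact scarfTop_unique v hv m a _ _ h hx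
        · exact absurd h (hYb b hab.symm hmab z)
      · rintro rfl; exact Or.inl hx
    · by_cases hb : b = i0
      · subst hb
        constructor
        · rintro (h | h)
          · exact absurd h (hYb a hab hmab.symm z)
          · exact scarfTop_unique v hv m b _ _ h hx
        · rintro rfl; exact Or.inr hx
      · rw [hmk a ha, hmk b hb] at hmab
        exact absurd (hs hmab) hab

open Classical in
lemma scarf (v : ι → A → β) (hv : ∀ i, Function.Injective (v i)) (s : ι → A)
    (hs : Function.Injective s)
    (hs1 : ∀ i a, v i (s i) ≤ v i a)
    (hs2 : ∀ i k a, k ≠ i → a ∉ Set.range s → v i a < v i (s k))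
    (c : A → ι) (hcs : ∀ i, c (s i) = i) (h2 : 2 ≤ Fintype.card ι) :
    ∃ P : Finset A, ScarfDom v P ∧ P.image c = Finset.univ := by
  by_contra hcon
  push Not at hcon
  obtain ⟨i0⟩ : Nonempty ι := Fintype.card_pos_iff.1 (by omega)
  let T : Finset (Finset A) := Finset.univ.filter fun τ =>
    τ.card + 1 = Fintype.card ι ∧ ScarfDom v τ ∧ τ.image c = Finset.univ.erase i0
  let F : Finset (Finset A × A) := Finset.univ.filter fun p =>
    p.1 ∈ T ∧ p.2 ∉ p.1 ∧ ScarfDom v (insert p.2 p.1)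
  have hF : ∀ p, p ∈ F ↔ p.1 ∈ T ∧ p.2 ∉ p.1 ∧ ScarfDom v (insert p.2 p.1) := by
    intro p; simp [F]
  have hT : ∀ τ, τ ∈ T ↔ τ.card + 1 = Fintype.card ι ∧ ScarfDom v τ ∧
      τ.image c = Finset.univ.erase i0 := by
    intro p; simp [T]
  -- count by doors
  have hodd : Odd F.card := by
    rw [Finset.card_eq_sum_card_fiberwise (f := Prod.fst) (t := T)
      (fun p hp => ((hF p).1 hp).1)]
    have hfib : ∀ τ ∈ T, (F.filter fun p => p.1 = τ).card =
        (Finset.univ.filter fun x => x ∉ τ ∧ ScarfDom v (insert x τ)).card := by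
      intro τ hτ
      symm
      apply Finset.card_bij (fun x _ => (τ, x))
      · intro x hx
        simp only [Finset.mem_filter, Finset.mem_univ, true_and] at hx
        simp [hF, hτ, hx]
      · intro x _ y _ h
        simpa using h
      · rintro ⟨τ', x⟩ h
        simp only [Finset.mem_filter, hF] at h
        obtain ⟨⟨h1, h2, h3⟩, rfl⟩ := h
        exact ⟨x, by simp [h2, h3], rfl⟩
    rw [Finset.sum_congr rfl hfib]
    set τ0 := (Finset.univ.erase i0).image s with hτ0
    have hTmem : τ0 ∈ T := by
      rw [hT]
      refine ⟨?_, ?_, ?_⟩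
      · rw [hτ0, Finset.card_image_of_injective _ hs, Finset.card_erase_of_mem (Finset.mem_univ _),
          Finset.card_univ]
        omega
      · intro y
        by_cases hy : y ∈ Set.range s
        · obtain ⟨k, rfl⟩ := hy
          exact ⟨k, fun t _ => hs1 k t⟩
        · refine ⟨i0, fun t ht => ?_⟩
          obtain ⟨k, hk, rfl⟩ := Finset.mem_image.1 ht
          exact (hs2 i0 k y (by simpa using hk) hy).le
      · rw [hτ0, Finset.image_image]
        have : c ∘ s = id := funext hcs
        rw [this, Finset.image_id]
    have hneT : ∀ τ ∈ T, τ.Nonempty := by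
      intro τ hτ
      have := ((hT τ).1 hτ).1
      exact Finset.card_pos.1 (by omega)
    have hmain := fun τ hτ => scarf_count v hv s hs hs1 hs2 τ (hneT τ hτ) ((hT τ).1 hτ).2.1
      ((hT τ).1 hτ).1
    rw [← Finset.add_sum_erase _ _ hTmem, (hmain τ0 hTmem).2 i0 rfl]
    apply Odd.add_even odd_one
    apply Finset.even_sum
    intro τ hτ
    obtain ⟨hτne, hτT⟩ := Finset.mem_erase.1 hτ
    rw [(hmain τ hτT).1]
    · exact even_two
    · by_contra hall
      push Not at hall
      apply hτne
      have hsub : τ ⊆ τ0 := by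
        intro t ht
        obtain ⟨k, rfl⟩ := hall t ht
        refine Finset.mem_image.2 ⟨k, ?_, rfl⟩
        have : c (s k) ∈ τ.image c := Finset.mem_image_of_mem _ ht
        rwa [hcs, ((hT τ).1 hτT).2.2] at this
      apply Finset.eq_of_subset_of_card_le hsub
      have h1 := ((hT τ).1 hτT).1
      have h2 := ((hT τ0).1 hTmem).1
      omega
  -- count by cells
  have heven : Even F.card := by
    rw [Finset.card_eq_sum_card_fiberwise (f := fun p => insert p.2 p.1)
      (t := (Finset.univ : Finset (Finset A))) (fun p hp => by simp)]
    apply Finset.even_sum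
    intro P _
    rcases Finset.eq_empty_or_nonempty (F.filter fun p => insert p.2 p.1 = P) with h | h
    · rw [h]; simp
    obtain ⟨⟨τ, x⟩, hp⟩ := h
    simp only [Finset.mem_filter, hF] at hp
    obtain ⟨⟨hτT, hx, hDx⟩, rfl⟩ := hp
    obtain ⟨hcard, hDτ, him⟩ := (hT τ).1 hτT
    have hinj : Set.InjOn c τ := by
      apply Finset.injOn_of_card_image_eq
      rw [him, Finset.card_erase_of_mem (Finset.mem_univ _), Finset.card_univ]; omega
    have hcx : c x ≠ i0 := by
      intro h
      apply hcon _ hDx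
      rw [Finset.image_insert, him, h, Finset.insert_erase (Finset.mem_univ _)]
    obtain ⟨x', hx', hcx'⟩ : ∃ x' ∈ τ, c x' = c x := by
      apply Finset.mem_image.1
      rw [him]; simp [hcx]
    have hxx' : x' ≠ x := by rintro rfl; exact hx hx'
    have hins : insert x' (insert x (τ.erase x')) = insert x τ := by
      rw [Finset.insert_comm, Finset.insert_erase hx']
    have : (F.filter fun p => insert p.2 p.1 = insert x τ).card = 2 := by
      rw [Finset.card_eq_two]
      refine ⟨(τ, x), (insert x (τ.erase x'), x'), ?_, ?_⟩
      · intro h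
        simp only [Prod.mk.injEq] at h
        exact hxx' h.2.symm
      · ext ⟨ρ, z⟩
        simp only [Finset.mem_filter, hF, Finset.mem_insert, Finset.mem_singleton, Prod.mk.injEq]
        constructor
        · rintro ⟨⟨hρT, hz, hDz⟩, heq⟩
          have hρ : ρ = (insert x τ).erase z := by rw [← heq, Finset.erase_insert hz]
          have hzP : z ∈ insert x τ := by rw [← heq]; simp
          by_cases hzx : z = x
          · left
            subst hzx
            exact ⟨by rw [hρ, Finset.erase_insert hx], rfl⟩
          by_cases hzx' : z = x'
          · right
            subst hzx'
            refine ⟨?_, rfl⟩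
            rw [hρ, Finset.erase_insert_of_ne (Ne.symm hzx)]
          exfalso
          have hzτ : z ∈ τ := by
            rcases Finset.mem_insert.1 hzP with h | h
            · exact absurd h hzx
            · exact h
          have hcz : c z ∈ ρ.image c := by
            rw [((hT ρ).1 hρT).2.2, ← him]
            exact Finset.mem_image_of_mem _ hzτ
          obtain ⟨y, hy, hyz⟩ := Finset.mem_image.1 hcz
          rw [hρ] at hy
          obtain ⟨hyne, hyP⟩ := Finset.mem_erase.1 hy
          rcases Finset.mem_insert.1 hyP with h | h
          · subst h
            exact hzx' (hinj hzτ hx' (hyz.symm.trans hcx'.symm))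
          · exact hyne (hinj h hzτ hyz)
        · rintro (⟨rfl, rfl⟩ | ⟨rfl, rfl⟩)
          · exact ⟨⟨hτT, hx, hDx⟩, rfl⟩
          · refine ⟨⟨?_, ?_, ?_⟩, hins⟩
            · rw [hT]
              refine ⟨?_, ?_, ?_⟩
              · rw [Finset.card_insert_of_notMem (fun h => hx (Finset.mem_of_mem_erase h)),
                  Finset.card_erase_of_mem hx']
                have := Finset.card_pos.2 ⟨z, hx'⟩
                omega
              · intro y
                obtain ⟨i, hi⟩ := hDx y
                refine ⟨i, fun t ht => hi t ?_⟩
                rw [← hins]; exact Finset.mem_insert_of_mem ht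
              · rw [Finset.image_insert, ← hcx', ← Finset.image_insert, Finset.insert_erase hx', him]
            · simp [hxx']
            · rw [hins]; exact hDx
    rw [this]; exact even_two
  exact (Nat.not_even_iff_odd.2 hodd) heven

end Scarf

section Brouwer

variable {ι : Type*} [Fintype ι] [DecidableEq ι]

/-- Grid points of the dilated simplex. -/
def GridPt (ι : Type*) [Fintype ι] (p : ℕ) : Type _ :=
  {x : ι → Fin (p + 1) // ∑ i, ((x i : Fin (p + 1)) : ℕ) = p}

noncomputable instance (p : ℕ) : Fintype (GridPt ι p) := by
  classical
  unfold GridPt; infer_instance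

lemma gridPt_of (p : ℕ) (y : ι → ℕ) (hy : ∑ i, y i = p) :
    ∃ g : GridPt ι p, ∀ i, ((g.1 i : Fin (p + 1)) : ℕ) = y i := by
  have hle : ∀ i, y i < p + 1 := fun i => by
    have := Finset.single_le_sum (f := y) (fun j _ => Nat.zero_le _) (Finset.mem_univ i)
    omega
  exact ⟨⟨fun i => ⟨y i, hle i⟩, by simpa using hy⟩, fun i => rfl⟩

/-- Level function for the Scarf orders. -/
def gridLevel (p : ℕ) (i : ι) : GridPt ι p ⊕ ι → ℤ
  | Sum.inl x => ((x.1 i : Fin (p + 1)) : ℕ)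
  | Sum.inr k => if k = i then -1 else p + 1

lemma grid_lemma (p : ℕ) (c : (ι → ℕ) → ι) (h2 : 2 ≤ Fintype.card ι) :
    ∃ x0 : ι → ℕ, ∑ i, x0 i = p ∧ ∀ i, x0 i ≤ Fintype.card ι ∨
      ∃ x : ι → ℕ, ∑ i, x i = p ∧ c x = i ∧
        ∀ k, x k ≤ x0 k + Fintype.card ι ∧ x0 k ≤ x k + Fintype.card ι := by
  classical
  let e := Fintype.equivFin (GridPt ι p ⊕ ι)
  let v : ι → GridPt ι p ⊕ ι → ℤ ×ₗ ℕ := fun i a => toLex (gridLevel p i a, (e a : ℕ))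
  have hv : ∀ i, Function.Injective (v i) := by
    intro i a b h
    have h1 : (gridLevel p i a, (e a : ℕ)) = (gridLevel p i b, (e b : ℕ)) := toLex.injective h
    have h3 : (e a : ℕ) = e b := (Prod.mk.inj h1).2
    exact e.injective (Fin.ext h3)
  have hlt : ∀ i a b, gridLevel p i a < gridLevel p i b → v i a < v i b := by
    intro i a b h
    exact Prod.Lex.toLex_lt_toLex.2 (Or.inl h)
  have hlev : ∀ i (x : GridPt ι p), 0 ≤ gridLevel p i (Sum.inl x) ∧
      gridLevel p i (Sum.inl x) < p + 1 := by
    intro i x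
    have := (x.1 i).2
    simp only [gridLevel]
    omega
  obtain ⟨P, hD, him⟩ := scarf v hv Sum.inr Sum.inr_injective
    (by
      rintro i (x | k)
      · apply le_of_lt; apply hlt
        have := hlev i x
        simp only [gridLevel, if_true] at this ⊢
        omega
      · by_cases hk : k = i
        · rw [hk]
        · apply le_of_lt; apply hlt
          simp only [gridLevel, if_true, if_neg hk]
          omega)
    (by
      rintro i k (x | j) hk hx
      · apply hlt
        have := hlev i x
        simp only [gridLevel, if_neg hk] at this ⊢
        omega
      · simp at hx)
    (Sum.elim (fun x => c (fun i => ((x.1 i : Fin (p + 1)) : ℕ))) id) (by intro i; rfl) h2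
  have hdom : ∀ y : ι → ℕ, ∑ i, y i = p → ∃ i, Sum.inr i ∉ P ∧
      ∀ x : GridPt ι p, Sum.inl x ∈ P → y i ≤ ((x.1 i : Fin (p + 1)) : ℕ) := by
    intro y hy
    obtain ⟨g, hg⟩ := gridPt_of p y hy
    obtain ⟨i, hi⟩ := hD (Sum.inl g)
    refine ⟨i, ?_, ?_⟩
    · intro h
      have h1 := hi _ h
      refine absurd h1 (not_le.2 (hlt _ _ _ ?_))
      have := hlev i g
      simp only [gridLevel, if_true] at this ⊢
      omega
    · intro x hx
      have h1 := hi _ hx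
      by_contra hcon
      refine absurd h1 (not_le.2 (hlt _ _ _ ?_))
      have := hg i
      simp only [gridLevel]
      omega
  let C : Finset ι := Finset.univ.filter fun i => Sum.inr i ∉ P
  have hC : ∀ i, i ∈ C ↔ Sum.inr i ∉ P := by intro i; simp [C]
  have hcol : ∀ i ∈ C, ∃ x : GridPt ι p, Sum.inl x ∈ P ∧
      c (fun i => ((x.1 i : Fin (p + 1)) : ℕ)) = i := by
    intro i hi
    have : i ∈ P.image (Sum.elim (fun x : GridPt ι p =>
        c (fun i => ((x.1 i : Fin (p + 1)) : ℕ))) id) := by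
      rw [him]; exact Finset.mem_univ _
    obtain ⟨a, ha, hai⟩ := Finset.mem_image.1 this
    rcases a with x | k
    · exact ⟨x, ha, hai⟩
    · simp only [Sum.elim_inr, id] at hai
      subst hai
      exact absurd ha ((hC k).1 hi)
  obtain ⟨j0⟩ : Nonempty ι := Fintype.card_pos_iff.1 (by omega)
  obtain ⟨i1, hi1, -⟩ := hdom (Pi.single j0 p) (by simp)
  have hi1C : i1 ∈ C := (hC i1).2 hi1
  obtain ⟨g0, hg0, -⟩ := hcol i1 hi1C
  have hm : ∀ i, ∃ g : GridPt ι p, Sum.inl g ∈ P ∧ ∀ x : GridPt ι p, Sum.inl x ∈ P →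
      ((g.1 i : Fin (p + 1)) : ℕ) ≤ ((x.1 i : Fin (p + 1)) : ℕ) := by
    intro i
    obtain ⟨g, hg, hg'⟩ := Finset.exists_min_image
      (Finset.univ.filter fun g : GridPt ι p => Sum.inl g ∈ P)
      (fun g => ((g.1 i : Fin (p + 1)) : ℕ)) ⟨g0, by simpa using hg0⟩
    exact ⟨g, by simpa using hg, fun x hx => hg' x (by simpa using hx)⟩
  choose g hgP hgmin using hm
  set m : ι → ℕ := fun i => (((g i).1 i : Fin (p + 1)) : ℕ) with hmdef
  have hsum : p < ∑ i ∈ C, (m i + 1) := by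
    by_contra hcon
    push Not at hcon
    obtain ⟨i, hi, hi'⟩ := hdom
      (fun i => if i ∈ C then m i + 1 + (if i = i1 then p - ∑ i ∈ C, (m i + 1) else 0) else 0) (by
        rw [Finset.sum_ite_mem, Finset.univ_inter, Finset.sum_add_distrib, Finset.sum_ite_eq',
          if_pos hi1C]
        omega)
    have h1 := hi' _ (hgP i)
    simp only [(hC i).2 hi, if_true] at h1
    change m i + 1 + _ ≤ m i at h1
    omega
  have hsum' : p < ∑ i ∈ C, m i + Fintype.card ι := by
    rw [Finset.sum_add_distrib] at hsum
    have : ∑ i ∈ C, 1 ≤ Fintype.card ι := by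
      rw [Finset.sum_const, smul_eq_mul, mul_one]
      exact Finset.card_le_univ C
    omega
  have hout : ∀ x : GridPt ι p, Sum.inl x ∈ P → ∀ k, k ∉ C →
      ((x.1 k : Fin (p + 1)) : ℕ) ≤ Fintype.card ι := by
    intro x hx k hk
    have h1 : ∑ i ∈ insert k C, ((x.1 i : Fin (p + 1)) : ℕ) ≤ p := by
      conv_rhs => rw [← x.2]
      exact Finset.sum_le_sum_of_subset (Finset.subset_univ _)
    rw [Finset.sum_insert hk] at h1
    have h3 : ∑ i ∈ C, m i ≤ ∑ i ∈ C, ((x.1 i : Fin (p + 1)) : ℕ) :=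
      Finset.sum_le_sum fun i _ => hgmin i x hx
    omega
  have hin : ∀ x : GridPt ι p, Sum.inl x ∈ P → ∀ k, k ∈ C →
      ((x.1 k : Fin (p + 1)) : ℕ) ≤ m k + Fintype.card ι := by
    intro x hx k hk
    have h1 : ∑ i ∈ C, ((x.1 i : Fin (p + 1)) : ℕ) ≤ p := by
      conv_rhs => rw [← x.2]
      exact Finset.sum_le_sum_of_subset (Finset.subset_univ _)
    rw [← Finset.add_sum_erase _ _ hk] at h1
    rw [← Finset.add_sum_erase _ _ hk] at hsum'
    have h3 : ∑ i ∈ C.erase k, m i ≤ ∑ i ∈ C.erase k, ((x.1 i : Fin (p + 1)) : ℕ) :=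
      Finset.sum_le_sum fun i _ => hgmin i x hx
    omega
  have hclose : ∀ x y : GridPt ι p, Sum.inl x ∈ P → Sum.inl y ∈ P → ∀ k,
      ((x.1 k : Fin (p + 1)) : ℕ) ≤ ((y.1 k : Fin (p + 1)) : ℕ) + Fintype.card ι := by
    intro x y hx hy k
    by_cases hk : k ∈ C
    · have h1 := hin x hx k hk
      have h3 : m k ≤ _ := hgmin k y hy
      omega
    · have h1 := hout x hx k hk
      omega
  refine ⟨fun i => ((g0.1 i : Fin (p + 1)) : ℕ), g0.2, fun i => ?_⟩
  by_cases hi : i ∈ C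
  · right
    obtain ⟨x, hx, hxc⟩ := hcol i hi
    exact ⟨_, x.2, hxc, fun k => ⟨hclose x g0 hx hg0 k, hclose g0 x hg0 hx k⟩⟩
  · left; exact hout g0 hg0 i hi

lemma brouwer_simplex (h2 : 2 ≤ Fintype.card ι) (f : (ι → ℝ) → ι → ℝ)
    (hf : ContinuousOn f (stdSimplex ℝ ι)) (hmap : ∀ x ∈ stdSimplex ℝ ι, f x ∈ stdSimplex ℝ ι) :
    ∃ x ∈ stdSimplex ℝ ι, f x = x := by
  classical
  have hsc : ∀ p : ℕ, 0 < p → ∀ x : ι → ℕ, ∑ i, x i = p →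
      (fun i => (x i : ℝ) / p) ∈ stdSimplex ℝ ι := by
    intro p hp x hx
    refine ⟨fun i => by positivity, ?_⟩
    have hp' : (p : ℝ) ≠ 0 := by positivity
    rw [← Finset.sum_div, div_eq_one_iff_eq hp', ← hx]
    push_cast; rfl
  obtain ⟨j0⟩ : Nonempty ι := Fintype.card_pos_iff.1 (by omega)
  have hcol : ∀ p : ℕ, ∃ c : (ι → ℕ) → ι, 0 < p → ∀ x : ι → ℕ, ∑ i, x i = p →
      (x (c x) : ℝ) / p ≤ f (fun i => (x i : ℝ) / p) (c x) := by
    intro p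
    have : ∀ x : ι → ℕ, ∃ i, 0 < p → ∑ i, x i = p →
        (x i : ℝ) / p ≤ f (fun i => (x i : ℝ) / p) i := by
      intro x
      by_cases h : 0 < p ∧ ∑ i, x i = p
      · have hs := hsc p h.1 x h.2
        have hs' := hmap _ hs
        obtain ⟨i, -, hi⟩ := Finset.exists_le_of_sum_le (s := (Finset.univ : Finset ι))
          (f := fun i => (x i : ℝ) / p) (g := f (fun i => (x i : ℝ) / p)) ⟨j0, Finset.mem_univ _⟩
          (by rw [hs'.2]; exact hs.2.le)
        exact ⟨i, fun _ _ => hi⟩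
      · exact ⟨j0, fun h1 h3 => absurd ⟨h1, h3⟩ h⟩
    choose c hc using this
    exact ⟨c, fun hp x hx => hc x hp hx⟩
  choose c hc using hcol
  choose x0 hx0 hx0' using fun p => grid_lemma (p + 1) (c (p + 1)) h2
  obtain ⟨x, hx, φ, hφ, hlim⟩ := (isCompact_stdSimplex ℝ ι).tendsto_subseq
    (x := fun p i => (x0 p i : ℝ) / (p + 1 : ℕ)) (fun p => hsc (p + 1) (Nat.succ_pos p) _ (hx0 p))
  refine ⟨x, hx, ?_⟩
  have hge : ∀ i, x i ≤ f x i := by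
    intro i
    by_contra hlt
    push Not at hlt
    have hxi : 0 < x i := lt_of_le_of_lt ((hmap x hx).1 i) hlt
    have hcont : ContinuousWithinAt (fun y => f y i - y i) (stdSimplex ℝ ι) x := by
      apply ContinuousWithinAt.sub
      · exact (continuous_apply i).continuousAt.comp_continuousWithinAt (hf x hx)
      · exact (continuous_apply i).continuousWithinAt
    have hev : ∀ᶠ y in nhdsWithin x (stdSimplex ℝ ι), f y i - y i < 0 :=
      hcont.eventually_lt_const (by linarith)
    obtain ⟨δ, hδ, hball⟩ := Metric.mem_nhdsWithin_iff.1 hev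
    have h1 : ∀ᶠ k in Filter.atTop, dist ((fun p i => (x0 p i : ℝ) / (p + 1 : ℕ)) (φ k)) x
        < min (δ / 2) (x i / 2) :=
      (Metric.tendsto_nhds.1 hlim) _ (by positivity)
    have h3 : Filter.Tendsto (fun k => (Fintype.card ι : ℝ) / (φ k + 1 : ℕ)) Filter.atTop (nhds 0) := by
      have h5 : Filter.Tendsto (fun k : ℕ => (Fintype.card ι : ℝ) / (k + 1 : ℕ)) Filter.atTop
          (nhds 0) := by
        apply Filter.Tendsto.div_atTop tendsto_const_nhds
        exact tendsto_natCast_atTop_atTop.comp (Filter.tendsto_add_atTop_nat 1)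
      exact h5.comp hφ.tendsto_atTop
    have h4 : ∀ᶠ k in Filter.atTop, (Fintype.card ι : ℝ) / (φ k + 1 : ℕ) < min (δ / 2) (x i / 2) :=
      h3.eventually_lt_const (by positivity)
    obtain ⟨k, hk1, hk2⟩ := (h1.and h4).exists
    have hp : (0 : ℝ) < (φ k + 1 : ℕ) := by positivity
    have hk3 : ∀ j, |(x0 (φ k) j : ℝ) / (φ k + 1 : ℕ) - x j| < min (δ / 2) (x i / 2) := by
      intro j
      exact lt_of_le_of_lt (dist_le_pi_dist ((fun p i => (x0 p i : ℝ) / (p + 1 : ℕ)) (φ k)) x j) hk1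
    rcases hx0' (φ k) i with h | ⟨y, hy, hyc, hyd⟩
    · have h6 : (x0 (φ k) i : ℝ) / (φ k + 1 : ℕ) ≤ (Fintype.card ι : ℝ) / (φ k + 1 : ℕ) := by
        gcongr
      have h7 := abs_lt.1 (hk3 i)
      have := min_le_right (δ / 2) (x i / 2)
      linarith
    · have hc1 := hc (φ k + 1) (Nat.succ_pos _) y hy
      rw [hyc] at hc1
      have hmem : (fun i => (y i : ℝ) / (φ k + 1 : ℕ)) ∈ Metric.ball x δ ∩ stdSimplex ℝ ι := by
        refine ⟨?_, hsc _ (Nat.succ_pos _) y hy⟩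
        rw [Metric.mem_ball, dist_pi_lt_iff hδ]
        intro j
        have h6 : |(y j : ℝ) / (φ k + 1 : ℕ) - (x0 (φ k) j : ℝ) / (φ k + 1 : ℕ)| ≤
            (Fintype.card ι : ℝ) / (φ k + 1 : ℕ) := by
          rw [← sub_div, abs_div, abs_of_pos hp]
          gcongr
          have h8 : (y j : ℝ) ≤ x0 (φ k) j + Fintype.card ι := by exact_mod_cast (hyd j).1
          have h9 : (x0 (φ k) j : ℝ) ≤ y j + Fintype.card ι := by exact_mod_cast (hyd j).2
          rw [abs_le]; constructor <;> linarith
        have h7 := abs_lt.1 (hk3 j)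
        have h8 := abs_le.1 h6
        have := min_le_left (δ / 2) (x i / 2)
        rw [Real.dist_eq, abs_lt]
        constructor <;> linarith
      have := hball hmem
      simp only [Set.mem_setOf_eq] at this
      linarith
  have hfx := hmap x hx
  have hsum : ∑ i, (f x i - x i) = 0 := by
    rw [Finset.sum_sub_distrib, hfx.2, hx.2, sub_self]
  have h0 := (Finset.sum_eq_zero_iff_of_nonneg (fun i _ => sub_nonneg.2 (hge i))).1 hsum
  funext i
  have := h0 i (Finset.mem_univ i)
  linarith

/-- Variational inequality on the cube. -/
lemma cube_vi (N : ℕ) (hN : 1 ≤ N) (G : (Fin N → ℝ) → Fin N → ℝ) (hG : Continuous G) :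
    ∃ y : Fin N → ℝ, (∀ i, 0 ≤ y i ∧ y i ≤ 1) ∧
      ∀ i, (0 < y i → 0 ≤ G y i) ∧ (y i < 1 → G y i ≤ 0) := by
  classical
  -- coordinates of the simplex: `Option (Fin N)`
  have hN' : (0 : ℝ) < N := by exact_mod_cast hN
  let ρ : (Option (Fin N) → ℝ) → Fin N → ℝ := fun x i => max 0 (min (N * x (some i)) 1)
  let T : (Option (Fin N) → ℝ) → Fin N → ℝ := fun x i => max 0 (min (ρ x i + G (ρ x) i) 1)
  have hT01 : ∀ x i, 0 ≤ T x i ∧ T x i ≤ 1 := fun x i =>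
    ⟨le_max_left _ _, max_le zero_le_one (min_le_right _ _)⟩
  let f : (Option (Fin N) → ℝ) → Option (Fin N) → ℝ := fun x o =>
    Option.elim o (1 - ∑ i, T x i / N) (fun i => T x i / N)
  have hρc : Continuous ρ := by
    apply continuous_pi; intro i
    exact continuous_const.max ((continuous_const.mul (continuous_apply _)).min continuous_const)
  have hTc : ∀ i, Continuous fun x => T x i := by
    intro i
    refine continuous_const.max (Continuous.min ?_ continuous_const)
    exact ((continuous_apply i).comp hρc).add ((continuous_apply i).comp (hG.comp hρc))
  have hfc : Continuous f := by
    apply continuous_pi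
    rintro (_ | i)
    · exact continuous_const.sub (continuous_finsetSum _ fun i _ => (hTc i).div_const _)
    · exact (hTc i).div_const _
  have hfm : ∀ x ∈ stdSimplex ℝ (Option (Fin N)), f x ∈ stdSimplex ℝ (Option (Fin N)) := by
    intro x _
    refine ⟨?_, ?_⟩
    · rintro (_ | i)
      · change 0 ≤ 1 - ∑ i, T x i / N
        have : ∑ i, T x i / N ≤ ∑ i : Fin N, (1 : ℝ) / N := by
          apply Finset.sum_le_sum; intro i _
          have := (hT01 x i).2
          gcongr
        rw [Finset.sum_const, Finset.card_univ, Fintype.card_fin, nsmul_eq_mul,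
          mul_one_div_cancel hN'.ne'] at this
        linarith
      · exact div_nonneg (hT01 x i).1 hN'.le
    · rw [Fintype.sum_option]
      change 1 - ∑ i, T x i / N + ∑ i, T x i / N = 1
      ring
  obtain ⟨x, -, hx⟩ := brouwer_simplex (by simp; omega) f hfc.continuousOn hfm
  have hx1 : ∀ i, N * x (some i) = T x i := by
    intro i
    have := congrFun hx (some i)
    change T x i / N = x (some i) at this
    rw [← this]; field_simp
  have hρ : ρ x = T x := by
    funext i
    change max 0 (min (N * x (some i)) 1) = _
    rw [hx1, min_eq_left (hT01 x i).2, max_eq_right (hT01 x i).1]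
  refine ⟨ρ x, fun i => by rw [hρ]; exact hT01 x i, fun i => ?_⟩
  have key : ρ x i = max 0 (min (ρ x i + G (ρ x) i) 1) := by
    conv_lhs => rw [hρ]
  refine ⟨fun hpos => ?_, fun hlt => ?_⟩
  · by_contra hneg
    push Not at hneg
    rcases le_total (ρ x i + G (ρ x) i) 1 with h | h
    · rw [min_eq_left h] at key
      rcases le_total 0 (ρ x i + G (ρ x) i) with h' | h'
      · rw [max_eq_right h'] at key; linarith
      · rw [max_eq_left h'] at key; linarith
    · have := (hT01 x i).2
      rw [← hρ] at this
      linarith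
  · by_contra hneg
    push Not at hneg
    rcases le_total (ρ x i + G (ρ x) i) 1 with h | h
    · rw [min_eq_left h] at key
      have := le_max_right 0 (ρ x i + G (ρ x) i)
      linarith
    · rw [min_eq_right h, max_eq_right zero_le_one] at key
      linarith

end Brouwer

section Game

variable {N : ℕ}

def pS (y : Fin N → ℝ) (i : Fin N) (S : Finset (Fin N)) : ℝ :=
  (∏ j ∈ S, y j) * ∏ j ∈ (Finset.univ.erase i) \ S, (1 - y j)

def cC (y : Fin N → ℝ) (i : Fin N) : ℝ := ∏ j ∈ Finset.univ.erase i, (1 - y j)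

def qQ (r : Finset (Fin N) → Fin N → ℝ) (y : Fin N → ℝ) (i : Fin N) : ℝ :=
  ∑ S ∈ (Finset.univ.erase i).powerset, pS y i S * r (insert i S) i

def aA (r : Finset (Fin N) → Fin N → ℝ) (y : Fin N → ℝ) (i : Fin N) : ℝ :=
  ∑ S ∈ (Finset.univ.erase i).powerset.erase ∅, pS y i S * r S i

def gG (r : Finset (Fin N) → Fin N → ℝ) (q : Fin N → ℝ) (l : ℝ) (y : Fin N → ℝ) (i : Fin N) : ℝ :=
  ∑ S ∈ (Finset.univ.erase i).powerset.erase ∅, pS y i S * (qQ r y i - r S i) +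
    cC y i * l * (qQ r y i - q i)

lemma pS_empty (y : Fin N → ℝ) (i : Fin N) : pS y i ∅ = cC y i := by simp [pS, cC]

lemma pS_sum (y : Fin N → ℝ) (i : Fin N) :
    ∑ S ∈ (Finset.univ.erase i).powerset, pS y i S = 1 := by
  unfold pS
  rw [← Finset.prod_add]
  simp

lemma pS_sum' (y : Fin N → ℝ) (i : Fin N) :
    ∑ S ∈ (Finset.univ.erase i).powerset.erase ∅, pS y i S = 1 - cC y i := by
  rw [Finset.sum_erase_eq_sub (by simp), pS_sum, pS_empty]

lemma gG_zero (r : Finset (Fin N) → Fin N → ℝ) (q : Fin N → ℝ) (y : Fin N → ℝ) (i : Fin N) :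
    gG r q 0 y i = qQ r y i * (1 - cC y i) - aA r y i := by
  rw [← pS_sum' y i]
  simp only [gG, aA, mul_sub, Finset.sum_sub_distrib, Finset.mul_sum]
  rw [Finset.sum_congr rfl (fun S _ => mul_comm (pS y i S) (qQ r y i))]
  ring

lemma continuous_pS (i : Fin N) (S : Finset (Fin N)) : Continuous fun y => pS y i S := by
  unfold pS; fun_prop

lemma continuous_cC (i : Fin N) : Continuous fun y => cC y i := by
  unfold cC; fun_prop

lemma continuous_qQ (r : Finset (Fin N) → Fin N → ℝ) (i : Fin N) :
    Continuous fun y => qQ r y i := by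
  unfold qQ
  exact continuous_finsetSum _ fun S _ => (continuous_pS i S).mul continuous_const

lemma continuous_aA (r : Finset (Fin N) → Fin N → ℝ) (i : Fin N) :
    Continuous fun y => aA r y i := by
  unfold aA
  exact continuous_finsetSum _ fun S _ => (continuous_pS i S).mul continuous_const

lemma continuous_gG (r : Finset (Fin N) → Fin N → ℝ) (q : Fin N → ℝ) (i : Fin N) :
    Continuous fun p : ℝ × (Fin N → ℝ) => gG r q p.1 p.2 i := by
  unfold gG
  have h1 := (continuous_qQ r i).comp (continuous_snd (X := ℝ) (Y := Fin N → ℝ))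
  have h2 := (continuous_cC i).comp (continuous_snd (X := ℝ) (Y := Fin N → ℝ))
  refine Continuous.add (continuous_finsetSum _ fun S _ => ?_) ?_
  · exact ((continuous_pS i S).comp continuous_snd).mul (h1.sub continuous_const)
  · exact (h2.mul continuous_fst).mul (h1.sub continuous_const)

lemma gG_tendsto (r : Finset (Fin N) → Fin N → ℝ) (q : Fin N → ℝ) (i : Fin N)
    (l : Filter ℕ) (lam : ℕ → ℝ) (y : ℕ → Fin N → ℝ) (Y : Fin N → ℝ)
    (h1 : Filter.Tendsto lam l (nhds 0)) (h2 : Filter.Tendsto y l (nhds Y)) :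
    Filter.Tendsto (fun k => gG r q (lam k) (y k) i) l (nhds (gG r q 0 Y i)) := by
  unfold gG
  have hQ : Filter.Tendsto (fun k => qQ r (y k) i) l (nhds (qQ r Y i)) :=
    ((continuous_qQ r i).tendsto Y).comp h2
  have hC : Filter.Tendsto (fun k => cC (y k) i) l (nhds (cC Y i)) :=
    ((continuous_cC i).tendsto Y).comp h2
  refine Filter.Tendsto.add (tendsto_finsetSum _ fun S _ => ?_)
    ((hC.mul h1).mul (hQ.sub_const _))
  have hP : Filter.Tendsto (fun k => pS (y k) i S) l (nhds (pS Y i S)) :=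
    ((continuous_pS i S).tendsto Y).comp h2
  exact hP.mul (hQ.sub_const _)

lemma cC_mem (y : Fin N → ℝ) (hy : ∀ i, 0 ≤ y i ∧ y i ≤ 1) (i : Fin N) :
    0 ≤ cC y i ∧ cC y i ≤ 1 := by
  unfold cC
  refine ⟨Finset.prod_nonneg fun j _ => by linarith [(hy j).2], ?_⟩
  exact Finset.prod_le_one (fun j _ => by linarith [(hy j).2]) (fun j _ => by linarith [(hy j).1])

lemma cC_lt (y : Fin N → ℝ) (hy : ∀ i, 0 ≤ y i ∧ y i ≤ 1) (i j : Fin N) (hij : j ≠ i)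
    (hj : 0 < y j) : cC y i < 1 := by
  unfold cC
  rw [← Finset.mul_prod_erase _ _ (Finset.mem_erase.2 ⟨hij, Finset.mem_univ j⟩)]
  have h1 : ∏ k ∈ (Finset.univ.erase i).erase j, (1 - y k) ≤ 1 :=
    Finset.prod_le_one (fun j _ => by linarith [(hy j).2]) (fun j _ => by linarith [(hy j).1])
  have h0 : 0 ≤ ∏ k ∈ (Finset.univ.erase i).erase j, (1 - y k) :=
    Finset.prod_nonneg fun j _ => by linarith [(hy j).2]
  nlinarith [(hy j).2]

lemma pS_eq_zero (y : Fin N → ℝ) (i j : Fin N) (S : Finset (Fin N)) (hj : j ∈ S) (h : y j = 0) :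
    pS y i S = 0 := by
  unfold pS
  rw [Finset.prod_eq_zero hj h, zero_mul]

lemma cC_solo (y : Fin N → ℝ) (i : Fin N) (h : ∀ j, j ≠ i → y j = 0) : cC y i = 1 := by
  unfold cC
  exact Finset.prod_eq_one fun j hj => by rw [h j (Finset.ne_of_mem_erase hj), sub_zero]

lemma mem_pow_ne {i j : Fin N} {S : Finset (Fin N)} (hS : S ∈ (Finset.univ.erase i).powerset)
    (hj : j ∈ S) : j ≠ i :=
  Finset.ne_of_mem_erase (Finset.mem_powerset.1 hS hj)

lemma qQ_solo (r : Finset (Fin N) → Fin N → ℝ) (hdiag : ∀ i : Fin N, r {i} i = 0)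
    (y : Fin N → ℝ) (i : Fin N) (h : ∀ j, j ≠ i → y j = 0) : qQ r y i = 0 := by
  unfold qQ
  apply Finset.sum_eq_zero
  intro S hS
  rcases S.eq_empty_or_nonempty with rfl | ⟨j, hj⟩
  · simp [hdiag]
  · rw [pS_eq_zero y i j S hj (h j (mem_pow_ne hS hj)), zero_mul]

lemma aA_solo (r : Finset (Fin N) → Fin N → ℝ)
    (y : Fin N → ℝ) (i : Fin N) (h : ∀ j, j ≠ i → y j = 0) : aA r y i = 0 := by
  unfold aA
  apply Finset.sum_eq_zero
  intro S hS
  obtain ⟨h1, hS⟩ := Finset.mem_erase.1 hS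
  obtain ⟨j, hj⟩ := Finset.nonempty_iff_ne_empty.2 h1
  rw [pS_eq_zero y i j S hj (h j (mem_pow_ne hS hj)), zero_mul]

lemma pS_nonneg (y : Fin N → ℝ) (hy : ∀ i, 0 ≤ y i ∧ y i ≤ 1) (i : Fin N) (S : Finset (Fin N)) :
    0 ≤ pS y i S := by
  unfold pS
  exact mul_nonneg (Finset.prod_nonneg fun j _ => (hy j).1)
    (Finset.prod_nonneg fun j _ => by linarith [(hy j).2])

lemma aA_pair (r : Finset (Fin N) → Fin N → ℝ)
    (y : Fin N → ℝ) (hy : ∀ i, 0 ≤ y i ∧ y i ≤ 1) (i j0 : Fin N)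
    (h : ∀ j, j ≠ i → j ≠ j0 → y j = 0) (hr : r {j0} i ≤ 0) : aA r y i ≤ 0 := by
  unfold aA
  apply Finset.sum_nonpos
  intro S hS
  obtain ⟨h1, hS⟩ := Finset.mem_erase.1 hS
  by_cases hSj : S = {j0}
  · subst hSj
    exact mul_nonpos_of_nonneg_of_nonpos (pS_nonneg y hy i _) hr
  · obtain ⟨j, hj, hjj⟩ : ∃ j ∈ S, j ≠ j0 := by
      by_contra hcon
      push Not at hcon
      apply hSj
      exact Finset.eq_singleton_iff_nonempty_unique_mem.2
        ⟨Finset.nonempty_iff_ne_empty.2 h1, hcon⟩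
    rw [pS_eq_zero y i j S hj (h j (mem_pow_ne hS hj) hjj), zero_mul]

lemma stage_sum (y : Fin N → ℝ) (i : Fin N) (x' : ℕ → ℝ) (t : ℕ) (φ : Finset (Fin N) → ℝ) :
    ∑ S ∈ nonempties N, termProb (Function.update (fun j (_ : ℕ) => y j) i x') t S * φ S =
      (∏ u ∈ Finset.range t, ((1 - x' u) * cC y i)) *
        (x' t * ∑ S ∈ (Finset.univ.erase i).powerset, pS y i S * φ (insert i S) +
          (1 - x' t) * ∑ S ∈ (Finset.univ.erase i).powerset.erase ∅, pS y i S * φ S) := by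
  set x := Function.update (fun j (_ : ℕ) => y j) i x' with hx
  have hxi : ∀ u, x i u = x' u := by intro u; simp [hx]
  have hxj : ∀ j, j ≠ i → ∀ u, x j u = y j := by intro j hj u; simp [hx, hj]
  have hprod : ∀ u, ∏ j, (1 - x j u) = (1 - x' u) * cC y i := by
    intro u
    rw [← Finset.mul_prod_erase _ _ (Finset.mem_univ i), hxi]
    congr 1
    exact Finset.prod_congr rfl fun j hj => by rw [hxj j (Finset.ne_of_mem_erase hj)]
  set s := ∏ u ∈ Finset.range t, ((1 - x' u) * cC y i) with hs
  have hterm : ∀ S, termProb x t S = s * ((∏ j ∈ S, x j t) * ∏ j ∈ Sᶜ, (1 - x j t)) := by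
    intro S
    simp only [termProb, hprod, hs]
  have hout : ∀ S ∈ (Finset.univ.erase i).powerset,
      termProb x t S = s * ((1 - x' t) * pS y i S) := by
    intro S hS
    rw [hterm]
    have hiS : i ∉ S := fun h => mem_pow_ne hS h rfl
    have hcompl : Sᶜ = insert i ((Finset.univ.erase i) \ S) := by
      ext j
      by_cases hj : j = i
      · subst hj; simp [hiS]
      · simp [hj]
    rw [hcompl, Finset.prod_insert (by simp), hxi]
    have e1 : ∏ j ∈ S, x j t = ∏ j ∈ S, y j :=
      Finset.prod_congr rfl fun j hj => hxj j (mem_pow_ne hS hj) t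
    have e2 : ∏ j ∈ (Finset.univ.erase i) \ S, (1 - x j t) =
        ∏ j ∈ (Finset.univ.erase i) \ S, (1 - y j) :=
      Finset.prod_congr rfl fun j hj => by
        rw [hxj j (Finset.ne_of_mem_erase (Finset.mem_sdiff.1 hj).1) t]
    rw [e1, e2, pS]; ring
  have hin : ∀ S ∈ (Finset.univ.erase i).powerset,
      termProb x t (insert i S) = s * (x' t * pS y i S) := by
    intro S hS
    rw [hterm]
    have hiS : i ∉ S := fun h => mem_pow_ne hS h rfl
    have hcompl : (insert i S)ᶜ = (Finset.univ.erase i) \ S := by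
      ext j
      by_cases hj : j = i
      · subst hj; simp
      · simp [hj]
    rw [hcompl, Finset.prod_insert hiS, hxi]
    have e1 : ∏ j ∈ S, x j t = ∏ j ∈ S, y j :=
      Finset.prod_congr rfl fun j hj => hxj j (mem_pow_ne hS hj) t
    have e2 : ∏ j ∈ (Finset.univ.erase i) \ S, (1 - x j t) =
        ∏ j ∈ (Finset.univ.erase i) \ S, (1 - y j) :=
      Finset.prod_congr rfl fun j hj => by
        rw [hxj j (Finset.ne_of_mem_erase (Finset.mem_sdiff.1 hj).1) t]
    rw [e1, e2, pS]; ring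
  have hne : nonempties N = (Finset.univ : Finset (Finset (Fin N))).erase ∅ := by
    ext S; simp [nonempties]
  have huniv : (Finset.univ : Finset (Finset (Fin N))) =
      (insert i (Finset.univ.erase i)).powerset := by
    rw [Finset.insert_erase (Finset.mem_univ i)]; simp
  have s1 : ∑ S ∈ (Finset.univ.erase i).powerset, termProb x t S * φ S =
      ∑ S ∈ (Finset.univ.erase i).powerset, s * ((1 - x' t) * pS y i S) * φ S :=
    Finset.sum_congr rfl (fun S hS => by rw [hout S hS])
  have s2 : ∑ S ∈ (Finset.univ.erase i).powerset, termProb x t (insert i S) * φ (insert i S) =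
      ∑ S ∈ (Finset.univ.erase i).powerset, s * (x' t * pS y i S) * φ (insert i S) :=
    Finset.sum_congr rfl (fun S hS => by rw [hin S hS])
  rw [hne, Finset.sum_erase_eq_sub (Finset.mem_univ _), huniv,
    Finset.sum_powerset_insert (by simp), Finset.sum_erase_eq_sub (by simp),
    hout ∅ (by simp), s1, s2]
  have s3 : ∑ S ∈ (Finset.univ.erase i).powerset, s * ((1 - x' t) * pS y i S) * φ S =
      s * (1 - x' t) * ∑ S ∈ (Finset.univ.erase i).powerset, pS y i S * φ S := by
    rw [Finset.mul_sum]; exact Finset.sum_congr rfl fun S _ => by ring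
  have s4 : ∑ S ∈ (Finset.univ.erase i).powerset, s * (x' t * pS y i S) * φ (insert i S) =
      s * x' t * ∑ S ∈ (Finset.univ.erase i).powerset, pS y i S * φ (insert i S) := by
    rw [Finset.mul_sum]; exact Finset.sum_congr rfl fun S _ => by ring
  rw [s3, s4]
  ring

lemma payoff_formula (r : Finset (Fin N) → Fin N → ℝ) (y : Fin N → ℝ)
    (hy : ∀ i, 0 ≤ y i ∧ y i ≤ 1) (i : Fin N) (hc : cC y i < 1) (x' : ℕ → ℝ)
    (hx' : ∀ t, x' t ∈ Set.Icc (0 : ℝ) 1) :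
    ∃ s : ℕ → ℝ, (∀ t, 0 ≤ s t) ∧ (∀ t, s (t + 1) = s t * ((1 - x' t) * cC y i)) ∧
      HasSum (fun t => s t - s (t + 1)) 1 ∧
      HasSum (fun t => s t * (x' t * qQ r y i + (1 - x' t) * aA r y i))
        (payoff r (Function.update (fun j (_ : ℕ) => y j) i x') i) := by
  set c := cC y i with hcdef
  have hc0 : 0 ≤ c := (cC_mem y hy i).1
  have hf : ∀ t, 0 ≤ (1 - x' t) * c ∧ (1 - x' t) * c ≤ c := fun t => by
    have := hx' t
    constructor
    · exact mul_nonneg (by linarith [this.2]) hc0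
    · nlinarith [this.1]
  let s : ℕ → ℝ := fun t => ∏ u ∈ Finset.range t, ((1 - x' u) * c)
  have hs0 : ∀ t, 0 ≤ s t := fun t => Finset.prod_nonneg fun u _ => (hf u).1
  have hs1 : ∀ t, s (t + 1) = s t * ((1 - x' t) * c) := fun t => Finset.prod_range_succ _ _
  have hsc : ∀ t, s t ≤ c ^ t := by
    intro t
    have := Finset.prod_le_prod (s := Finset.range t) (fun u _ => (hf u).1) (fun u _ => (hf u).2)
    simpa [s] using this
  have hs_lim : Filter.Tendsto s Filter.atTop (nhds 0) :=
    squeeze_zero hs0 hsc (tendsto_pow_atTop_nhds_zero_of_lt_one hc0 hc)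
  have hanti : ∀ t, 0 ≤ s t - s (t + 1) := by
    intro t
    rw [hs1]
    have := hf t
    nlinarith [hs0 t]
  have htel : HasSum (fun t => s t - s (t + 1)) 1 := by
    rw [hasSum_iff_tendsto_nat_of_nonneg hanti]
    have : ∀ n, ∑ t ∈ Finset.range n, (s t - s (t + 1)) = 1 - s n := by
      intro n
      rw [Finset.sum_range_sub']
      simp [s]
    simp only [this]
    simpa using hs_lim.const_sub 1
  refine ⟨s, hs0, hs1, htel, ?_⟩
  have hsummable : Summable (fun t => s t * (x' t * qQ r y i + (1 - x' t) * aA r y i)) := by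
    apply Summable.of_norm_bounded (g := fun t => c ^ t * (|qQ r y i| + |aA r y i|))
    · exact (summable_geometric_of_lt_one hc0 hc).mul_right _
    · intro t
      rw [norm_mul, Real.norm_eq_abs, Real.norm_eq_abs, abs_of_nonneg (hs0 t)]
      refine mul_le_mul (hsc t) ?_ (abs_nonneg _) (pow_nonneg hc0 t)
      refine (abs_add_le _ _).trans ?_
      rw [abs_mul, abs_mul, abs_of_nonneg (show (0 : ℝ) ≤ x' t from (hx' t).1),
        abs_of_nonneg (show (0 : ℝ) ≤ 1 - x' t by linarith [(hx' t).2])]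
      have h1 := hx' t
      refine add_le_add ?_ ?_
      · nlinarith [abs_nonneg (qQ r y i), h1.2]
      · nlinarith [abs_nonneg (aA r y i), h1.1]
  have e1 : ∀ t, ∑ S ∈ nonempties N,
      termProb (Function.update (fun j (_ : ℕ) => y j) i x') t S * r S i =
      s t * (x' t * qQ r y i + (1 - x' t) * aA r y i) := fun t =>
    stage_sum y i x' t (fun S => r S i)
  have e2 : ∀ t, ∑ S ∈ nonempties N,
      termProb (Function.update (fun j (_ : ℕ) => y j) i x') t S = s t - s (t + 1) := by
    intro t
    have := stage_sum y i x' t (fun _ => 1)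
    simp only [mul_one, pS_sum, pS_sum'] at this
    rw [this, hs1]
    change s t * _ = _
    ring
  unfold payoff
  simp only [e1, e2]
  rw [htel.tsum_eq, sub_self, zero_mul, add_zero]
  exact hsummable.hasSum

lemma eps_criterion (r : Finset (Fin N) → Fin N → ℝ) (y : Fin N → ℝ)
    (hy : ∀ i, 0 ≤ y i ∧ y i ≤ 1) (ε : ℝ)
    (h : ∀ i, cC y i < 1 ∧ ∃ V, y i * qQ r y i + (1 - y i) * aA r y i =
        V * (y i + (1 - y i) * (1 - cC y i)) ∧
      qQ r y i ≤ V + ε ∧ aA r y i ≤ (1 - cC y i) * (V + ε)) :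
    ∃ x : Fin N → ℕ → ℝ, (∀ i t, x i t = x i 0) ∧ IsEpsEquilibrium r x ε := by
  refine ⟨fun j _ => y j, fun _ _ => rfl, fun i _ => hy i, ?_⟩
  intro i x' hx'
  obtain ⟨hc, V, hV, hQ, hA⟩ := h i
  have hself : payoff r (fun j (_ : ℕ) => y j) i = V := by
    obtain ⟨s, hs0, hs1, htel, hpay⟩ := payoff_formula r y hy i hc (fun _ => y i) (fun _ => hy i)
    have hupd : Function.update (fun j (_ : ℕ) => y j) i (fun _ => y i) = fun j (_ : ℕ) => y j :=
      Function.update_eq_self i (fun j (_ : ℕ) => y j)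
    rw [hupd] at hpay
    have h2 := htel.mul_left V
    rw [mul_one] at h2
    have e : (fun t => s t * (y i * qQ r y i + (1 - y i) * aA r y i)) =
        fun t => V * (s t - s (t + 1)) := by
      funext t; rw [hV, hs1]; ring
    rw [e] at hpay
    exact hpay.unique h2
  rw [hself]
  obtain ⟨s, hs0, hs1, htel, hpay⟩ := payoff_formula r y hy i hc x' hx'
  have h2 := htel.mul_left (V + ε)
  rw [mul_one] at h2
  have := hasSum_le (fun t => ?_) hpay h2
  · linarith
  · rw [hs1]
    have h3 : x' t * qQ r y i + (1 - x' t) * aA r y i ≤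
        (V + ε) * (x' t + (1 - x' t) * (1 - cC y i)) := by
      have h4 := mul_le_mul_of_nonneg_left hQ (hx' t).1
      have h5 := mul_le_mul_of_nonneg_left hA (sub_nonneg.2 (hx' t).2)
      nlinarith
    have := mul_le_mul_of_nonneg_left h3 (hs0 t)
    nlinarith

open Filter in
/-- Two or more quitters in the limit. -/
lemma case_two (r : Finset (Fin N) → Fin N → ℝ) (q : Fin N → ℝ) (Y : Fin N → ℝ)
    (hY : ∀ i, 0 ≤ Y i ∧ Y i ≤ 1) (a b : Fin N) (hab : a ≠ b) (ha : 0 < Y a) (hb : 0 < Y b)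
    (hg1 : ∀ i, 0 < Y i → 0 ≤ gG r q 0 Y i) (hg2 : ∀ i, Y i < 1 → gG r q 0 Y i ≤ 0)
    (ε : ℝ) (hε : 0 < ε) :
    ∃ x : Fin N → ℕ → ℝ, (∀ i t, x i t = x i 0) ∧ IsEpsEquilibrium r x ε := by
  apply eps_criterion r Y hY ε
  intro i
  have hc : cC Y i < 1 := by
    by_cases hia : a = i
    · exact cC_lt Y hY i b (by rw [← hia]; exact hab.symm) hb
    · exact cC_lt Y hY i a hia ha
  refine ⟨hc, ?_⟩
  have h1 := hg1 i
  have h2 := hg2 i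
  rw [gG_zero] at h1 h2
  rcases (hY i).1.eq_or_lt with h0 | hpos
  · have hc' : 0 < 1 - cC Y i := by linarith
    have h3 := h2 (by rw [← h0]; norm_num)
    refine ⟨aA r Y i / (1 - cC Y i), ?_, ?_, ?_⟩
    · rw [← h0]; field_simp; ring
    · have : qQ r Y i ≤ aA r Y i / (1 - cC Y i) := by
        rw [le_div_iff₀ hc']; linarith
      linarith
    · rw [mul_add, mul_div_cancel₀ _ hc'.ne']
      nlinarith
  · have h4 := h1 hpos
    refine ⟨qQ r Y i, ?_, by linarith, ?_⟩
    · rcases (hY i).2.eq_or_lt with h1' | hlt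
      · rw [h1']; ring
      · have h5 := h2 hlt
        have : aA r Y i = qQ r Y i * (1 - cC Y i) := by linarith
        rw [this]; ring
    · nlinarith

open Filter Topology in
/-- Exactly one quitter in the limit. -/
lemma case_one (r : Finset (Fin N) → Fin N → ℝ) (hdiag : ∀ i : Fin N, r {i} i = 0)
    (q : Fin N → ℝ) (Y : Fin N → ℝ)
    (hY : ∀ i, 0 ≤ Y i ∧ Y i ≤ 1) (i j : Fin N) (hij : j ≠ i) (hi : 0 < Y i)
    (hsolo : ∀ k, k ≠ i → Y k = 0) (hr : r {j} i ≤ 0)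
    (hg2 : ∀ i, Y i < 1 → gG r q 0 Y i ≤ 0)
    (ε : ℝ) (hε : 0 < ε) :
    ∃ x : Fin N → ℕ → ℝ, (∀ i t, x i t = x i 0) ∧ IsEpsEquilibrium r x ε := by
  let y : ℝ → Fin N → ℝ := fun δ => Function.update Y j δ
  have hy0 : y 0 = Y := by
    funext k
    by_cases hk : k = j
    · subst hk; simp [y, hsolo k hij]
    · simp [y, hk]
  have hyi : ∀ δ, y δ i = Y i := fun δ => by simp [y, hij.symm]
  have hlim : Tendsto y (𝓝[>] 0) (𝓝 Y) := by
    have : Continuous y := by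
      apply continuous_pi; intro k
      by_cases hk : k = j
      · subst hk; simpa [y] using continuous_id'
      · simpa [y, hk] using continuous_const
    have h2 := this.tendsto 0
    rw [hy0] at h2
    exact h2.mono_left nhdsWithin_le_nhds
  have hQl : ∀ k, Tendsto (fun δ => qQ r (y δ) k) (𝓝[>] 0) (𝓝 (qQ r Y k)) := fun k =>
    ((continuous_qQ r k).tendsto Y).comp hlim
  have hAl : ∀ k, Tendsto (fun δ => aA r (y δ) k) (𝓝[>] 0) (𝓝 (aA r Y k)) := fun k =>
    ((continuous_aA r k).tendsto Y).comp hlim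
  have hCl : ∀ k, Tendsto (fun δ => cC (y δ) k) (𝓝[>] 0) (𝓝 (cC Y k)) := fun k =>
    ((continuous_cC k).tendsto Y).comp hlim
  have hYl : ∀ k, Tendsto (fun δ => y δ k) (𝓝[>] 0) (𝓝 (Y k)) := fun k =>
    ((continuous_apply k).tendsto Y).comp hlim
  have hden : ∀ k, 0 < Y k + (1 - Y k) * (1 - cC Y k) := by
    intro k
    have hc := cC_mem Y hY k
    by_cases hk : k = i
    · subst hk
      have := hY k
      nlinarith
    · rw [hsolo k hk]
      have := cC_lt Y hY k i (Ne.symm hk) hi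
      linarith
  let V : ℝ → Fin N → ℝ := fun δ k => (y δ k * qQ r (y δ) k + (1 - y δ k) * aA r (y δ) k) /
    (y δ k + (1 - y δ k) * (1 - cC (y δ) k))
  let V0 : Fin N → ℝ := fun k => (Y k * qQ r Y k + (1 - Y k) * aA r Y k) /
    (Y k + (1 - Y k) * (1 - cC Y k))
  have hVl : ∀ k, Tendsto (fun δ => V δ k) (𝓝[>] 0) (𝓝 (V0 k)) := by
    intro k
    apply Tendsto.div _ _ (hden k).ne'
    · exact ((hYl k).mul (hQl k)).add (((hYl k).const_sub 1).mul (hAl k))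
    · exact (hYl k).add (((hYl k).const_sub 1).mul ((hCl k).const_sub 1))
  have hdenl : ∀ k, ∀ᶠ δ in 𝓝[>] (0 : ℝ), 0 < y δ k + (1 - y δ k) * (1 - cC (y δ) k) := by
    intro k
    have : Tendsto (fun δ => y δ k + (1 - y δ k) * (1 - cC (y δ) k)) (𝓝[>] 0)
        (𝓝 (Y k + (1 - Y k) * (1 - cC Y k))) :=
      (hYl k).add (((hYl k).const_sub 1).mul ((hCl k).const_sub 1))
    exact this.eventually_const_lt (hden k)
  have hδ : ∀ᶠ δ in 𝓝[>] (0 : ℝ), 0 < δ ∧ δ < 1 := by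
    filter_upwards [Ioo_mem_nhdsGT (zero_lt_one' ℝ)] with δ h using h
  have hmain : ∀ k, ∀ᶠ δ in 𝓝[>] (0 : ℝ), qQ r (y δ) k ≤ V δ k + ε ∧
      aA r (y δ) k ≤ (1 - cC (y δ) k) * (V δ k + ε) := by
    intro k
    by_cases hk : k = i
    · subst hk
      have hQ0 : qQ r Y k = 0 := qQ_solo r hdiag Y k hsolo
      have hA0 : aA r Y k = 0 := aA_solo r Y k hsolo
      have hV0 : V0 k = 0 := by simp [V0, hQ0, hA0]
      have e1 : ∀ᶠ δ in 𝓝[>] (0 : ℝ), qQ r (y δ) k < V δ k + ε :=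
        (hQl k).eventually_lt ((hVl k).add_const ε) (by rw [hQ0, hV0]; linarith)
      have e2 : ∀ᶠ δ in 𝓝[>] (0 : ℝ), 0 < V δ k + ε :=
        ((hVl k).add_const ε).eventually_const_lt (by rw [hV0]; linarith)
      filter_upwards [e1, e2, hδ] with δ h1 h2 h3
      refine ⟨h1.le, ?_⟩
      have hy01 : ∀ m, 0 ≤ y δ m ∧ y δ m ≤ 1 := by
        intro m
        by_cases hm : m = j
        · subst hm; simp [y, h3.1.le, h3.2.le]
        · simpa [y, hm] using hY m
      have h4 : aA r (y δ) k ≤ 0 := by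
        apply aA_pair r (y δ) hy01 k j _ hr
        intro m hm hmj
        simp [y, hmj, hsolo m hm]
      have h5 := (cC_mem (y δ) hy01 k).2
      have : 0 ≤ (1 - cC (y δ) k) * (V δ k + ε) := mul_nonneg (by linarith) h2.le
      linarith
    · have hc := cC_lt Y hY k i (Ne.symm hk) hi
      have hc' : 0 < 1 - cC Y k := by linarith
      have hg := hg2 k (by rw [hsolo k hk]; norm_num)
      rw [gG_zero] at hg
      have hV0 : V0 k = aA r Y k / (1 - cC Y k) := by simp [V0, hsolo k hk]
      have hQV : qQ r Y k ≤ V0 k := by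
        rw [hV0, le_div_iff₀ hc']; linarith
      have hAV : aA r Y k = (1 - cC Y k) * V0 k := by
        rw [hV0, mul_div_cancel₀ _ hc'.ne']
      have e1 : ∀ᶠ δ in 𝓝[>] (0 : ℝ), qQ r (y δ) k < V δ k + ε :=
        (hQl k).eventually_lt ((hVl k).add_const ε) (by linarith)
      have e2 : ∀ᶠ δ in 𝓝[>] (0 : ℝ), aA r (y δ) k < (1 - cC (y δ) k) * (V δ k + ε) :=
        (hAl k).eventually_lt (((hCl k).const_sub 1).mul ((hVl k).add_const ε)) (by
          rw [hAV]; nlinarith)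
      filter_upwards [e1, e2] with δ h1 h2
      exact ⟨h1.le, h2.le⟩
  obtain ⟨δ, h1, h2, h3⟩ :=
    ((eventually_all.2 hmain).and ((eventually_all.2 hdenl).and hδ)).exists
  have hy01 : ∀ m, 0 ≤ y δ m ∧ y δ m ≤ 1 := by
    intro m
    by_cases hm : m = j
    · subst hm; simp [y, h3.1.le, h3.2.le]
    · simpa [y, hm] using hY m
  apply eps_criterion r (y δ) hy01 ε
  intro k
  refine ⟨?_, V δ k, ?_, h1 k⟩
  · by_cases hk : i = k
    · refine cC_lt (y δ) hy01 k j (hk ▸ hij) ?_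
      simpa [y] using h3.1
    · refine cC_lt (y δ) hy01 k i hk ?_
      rw [hyi]; exact hi
  · exact (div_mul_cancel₀ _ (h2 k).ne').symm

open Filter Topology in
lemma gG_div_tendsto (r : Finset (Fin N) → Fin N → ℝ) (hdiag : ∀ i : Fin N, r {i} i = 0)
    (q : Fin N → ℝ) (l : Filter ℕ) (y : ℕ → Fin N → ℝ) (Y : Fin N → ℝ) (i : Fin N)
    (hy : Tendsto y l (𝓝 Y)) (hsolo : ∀ j, j ≠ i → Y j = 0)
    (lam σ : ℕ → ℝ) (z0 : ℝ) (z : Fin N → ℝ)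
    (hz0 : Tendsto (fun k => lam k / σ k) l (𝓝 z0))
    (hz : ∀ j, j ≠ i → Tendsto (fun k => y k j / σ k) l (𝓝 (z j))) :
    Tendsto (fun k => gG r q (lam k) (y k) i / σ k) l
      (𝓝 (-(z0 * q i + ∑ j ∈ Finset.univ.erase i, z j * r {j} i))) := by
  have hQ : Tendsto (fun k => qQ r (y k) i) l (𝓝 0) := by
    have := ((continuous_qQ r i).tendsto Y).comp hy
    rwa [qQ_solo r hdiag Y i hsolo] at this
  have hC : Tendsto (fun k => cC (y k) i) l (𝓝 1) := by
    have := ((continuous_cC i).tendsto Y).comp hy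
    rwa [cC_solo Y i hsolo] at this
  have hyj : ∀ j, j ≠ i → Tendsto (fun k => y k j) l (𝓝 0) := by
    intro j hj
    have := ((continuous_apply j).tendsto Y).comp hy
    rwa [hsolo j hj] at this
  let L : Finset (Fin N) → ℝ := fun S => ∑ j ∈ Finset.univ.erase i, if S = {j} then z j else 0
  have hP : ∀ S ∈ (Finset.univ.erase i).powerset.erase ∅,
      Tendsto (fun k => pS (y k) i S / σ k) l (𝓝 (L S)) := by
    intro S hS
    obtain ⟨h1, hS⟩ := Finset.mem_erase.1 hS
    obtain ⟨j, hj⟩ := Finset.nonempty_iff_ne_empty.2 h1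
    have hji := mem_pow_ne hS hj
    have e : ∀ k, pS (y k) i S / σ k = (y k j / σ k) * ((∏ m ∈ S.erase j, y k m) *
        ∏ m ∈ (Finset.univ.erase i) \ S, (1 - y k m)) := by
      intro k
      rw [pS, ← Finset.mul_prod_erase _ _ hj]; ring
    simp only [e]
    have e1 : Tendsto (fun k => ∏ m ∈ S.erase j, y k m) l (𝓝 (∏ m ∈ S.erase j, (0 : ℝ))) :=
      tendsto_finsetProd _ fun m hm => hyj m (mem_pow_ne hS (Finset.mem_of_mem_erase hm))
    have e2 : Tendsto (fun k => ∏ m ∈ (Finset.univ.erase i) \ S, (1 - y k m)) l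
        (𝓝 (∏ m ∈ (Finset.univ.erase i) \ S, ((1 : ℝ) - 0))) :=
      tendsto_finsetProd _ fun m hm =>
        (hyj m (Finset.ne_of_mem_erase (Finset.mem_sdiff.1 hm).1)).const_sub 1
    have e3 := (hz j hji).mul (e1.mul e2)
    convert e3 using 2
    by_cases hSj : S = {j}
    · subst hSj
      simp [L, Finset.sum_ite_eq, hji]
    · have hne : (S.erase j).Nonempty := by
        rw [Finset.nonempty_iff_ne_empty, Ne, Finset.erase_eq_empty_iff]
        rintro (h | h)
        · exact h1 h
        · exact hSj h
      obtain ⟨m, hm⟩ := hne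
      rw [Finset.prod_eq_zero hm rfl]
      simp only [zero_mul, mul_zero, L]
      apply Finset.sum_eq_zero
      intro m' _
      rw [if_neg]
      rintro rfl
      rw [Finset.mem_singleton] at hj
      exact hSj (by rw [hj])
  have hG : ∀ k, gG r q (lam k) (y k) i / σ k =
      ∑ S ∈ (Finset.univ.erase i).powerset.erase ∅,
        (pS (y k) i S / σ k) * (qQ r (y k) i - r S i) +
      cC (y k) i * (lam k / σ k) * (qQ r (y k) i - q i) := by
    intro k
    rw [gG, add_div, Finset.sum_div]
    congr 1
    · exact Finset.sum_congr rfl fun S _ => by ring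
    · ring
  simp only [hG]
  have h1 : Tendsto (fun k => ∑ S ∈ (Finset.univ.erase i).powerset.erase ∅,
        (pS (y k) i S / σ k) * (qQ r (y k) i - r S i)) l
      (𝓝 (∑ S ∈ (Finset.univ.erase i).powerset.erase ∅, L S * (0 - r S i))) :=
    tendsto_finsetSum _ fun S hS => (hP S hS).mul (hQ.sub_const _)
  have h2 := h1.add ((hC.mul hz0).mul (hQ.sub_const (q i)))
  convert h2 using 2
  have : ∑ S ∈ (Finset.univ.erase i).powerset.erase ∅, L S * (0 - r S i) =
      - ∑ j ∈ Finset.univ.erase i, z j * r {j} i := by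
    simp only [L, Finset.sum_mul]
    rw [Finset.sum_comm, ← Finset.sum_neg_distrib]
    apply Finset.sum_congr rfl
    intro j hj
    rw [Finset.sum_eq_single {j}]
    · simp
    · intro S _ hS
      rw [if_neg hS, zero_mul]
    · intro h
      exfalso; apply h
      simp only [Finset.mem_erase, Finset.mem_powerset, Finset.singleton_subset_iff]
      exact ⟨Finset.singleton_ne_empty j, Finset.mem_erase.1 hj⟩
  rw [this]; ring

open Filter Topology in
lemma ultra_lim (U : Ultrafilter ℕ) (f : ℕ → ℝ) (hf : ∀ k, 0 ≤ f k ∧ f k ≤ 1) :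
    ∃ z, 0 ≤ z ∧ Tendsto f U (𝓝 z) := by
  obtain ⟨z, hz, hle⟩ := (isCompact_Icc (a := (0 : ℝ)) (b := 1)).ultrafilter_le_nhds
    (U.map f) (by
      rw [Filter.le_principal_iff, Ultrafilter.coe_map, Filter.mem_map]
      exact Filter.Eventually.of_forall hf)
  exact ⟨z, hz.1, hle⟩

open Filter Topology in
lemma abnormal_zero (r : Finset (Fin N) → Fin N → ℝ) (hdiag : ∀ i : Fin N, r {i} i = 0)
    (q : Fin N → ℝ) (U : Ultrafilter ℕ) (y : ℕ → Fin N → ℝ) (Y : Fin N → ℝ) (i : Fin N)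
    (hy01 : ∀ k i, 0 ≤ y k i ∧ y k i ≤ 1)
    (hy : Tendsto y U (𝓝 Y)) (hsolo : ∀ j, j ≠ i → Y j = 0)
    (lam : ℕ → ℝ) (hlam : ∀ k, 0 < lam k)
    (hg : ∀ k, 0 < y k i → 0 ≤ gG r q (lam k) (y k) i)
    (hq : 0 < q i)
    (hr : ∀ j, j ≠ i → 0 < r {j} i ∨ ∀ᶠ k in (U : Filter ℕ), y k j = 0) :
    ∀ᶠ k in (U : Filter ℕ), y k i = 0 := by
  let σ : ℕ → ℝ := fun k => lam k + ∑ j ∈ Finset.univ.erase i, y k j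
  have hsn : ∀ k, 0 ≤ ∑ j ∈ Finset.univ.erase i, y k j := fun k =>
    Finset.sum_nonneg fun j _ => (hy01 k j).1
  have hσ : ∀ k, 0 < σ k := fun k => add_pos_of_pos_of_nonneg (hlam k) (hsn k)
  obtain ⟨z0, hz0n, hz0⟩ := ultra_lim U (fun k => lam k / σ k) (fun k =>
    ⟨div_nonneg (hlam k).le (hσ k).le, (div_le_one (hσ k)).2 (by linarith [hsn k])⟩)
  have hzex : ∀ j, ∃ z, j ≠ i → 0 ≤ z ∧ Tendsto (fun k => y k j / σ k) U (𝓝 z) := by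
    intro j
    by_cases hj : j = i
    · exact ⟨0, fun h => absurd hj h⟩
    · obtain ⟨z, h⟩ := ultra_lim U (fun k => y k j / σ k) (fun k =>
        ⟨div_nonneg (hy01 k j).1 (hσ k).le, (div_le_one (hσ k)).2 (by
          have := Finset.single_le_sum (f := fun j => y k j) (s := Finset.univ.erase i)
            (fun j _ => (hy01 k j).1) (Finset.mem_erase.2 ⟨hj, Finset.mem_univ j⟩)
          have h2 := hlam k
          simp only [σ] at this ⊢
          linarith)⟩)
      exact ⟨z, fun _ => h⟩
  choose z hz using hzex
  have hsum : z0 + ∑ j ∈ Finset.univ.erase i, z j = 1 := by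
    have h1 : Tendsto (fun k => lam k / σ k + ∑ j ∈ Finset.univ.erase i, y k j / σ k) U
        (𝓝 (z0 + ∑ j ∈ Finset.univ.erase i, z j)) :=
      hz0.add (tendsto_finsetSum _ fun j hj => (hz j (Finset.ne_of_mem_erase hj)).2)
    have h2 : (fun k => lam k / σ k + ∑ j ∈ Finset.univ.erase i, y k j / σ k) = fun _ => 1 := by
      funext k
      rw [← Finset.sum_div, ← add_div]
      exact div_self (hσ k).ne'
    rw [h2] at h1
    exact tendsto_nhds_unique h1 tendsto_const_nhds
  have hterm : ∀ j ∈ Finset.univ.erase i, 0 ≤ z j * r {j} i ∧ (z j * r {j} i = 0 → z j = 0) := by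
    intro j hj
    have hji := Finset.ne_of_mem_erase hj
    rcases hr j hji with h | h
    · exact ⟨mul_nonneg (hz j hji).1 h.le, fun h0 => (mul_eq_zero.1 h0).resolve_right h.ne'⟩
    · have : z j = 0 := by
        refine tendsto_nhds_unique (hz j hji).2 ?_
        refine tendsto_const_nhds.congr' ?_
        filter_upwards [h] with k hk
        rw [hk, zero_div]
      simp [this]
  have hpos : 0 < z0 * q i + ∑ j ∈ Finset.univ.erase i, z j * r {j} i := by
    have hs0 := Finset.sum_nonneg fun j hj => (hterm j hj).1
    rcases hz0n.eq_or_lt with h0 | h0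
    · rcases hs0.eq_or_lt with h1 | h1
      · exfalso
        have h2 := (Finset.sum_eq_zero_iff_of_nonneg fun j hj => (hterm j hj).1).1 h1.symm
        rw [← h0, Finset.sum_eq_zero fun j hj => (hterm j hj).2 (h2 j hj)] at hsum
        norm_num at hsum
      · rw [← h0, zero_mul, zero_add]; exact h1
    · have := mul_pos h0 hq
      linarith
  have hlim := gG_div_tendsto r hdiag q U y Y i hy hsolo lam σ z0 z hz0 (fun j hj => (hz j hj).2)
  have hneg := hlim.eventually_lt_const (neg_neg_of_pos hpos)
  filter_upwards [hneg] with k hk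
  by_contra hne
  have h1 := hg k (lt_of_le_of_ne (hy01 k i).1 (Ne.symm hne))
  have := div_nonneg h1 (hσ k).le
  linarith

lemma sum_castLE {n : ℕ} (hnN : n ≤ N) (F : Fin N → ℝ) (hF : ∀ i : Fin N, ¬ (i : ℕ) < n → F i = 0) :
    ∑ i : Fin n, F (Fin.castLE hnN i) = ∑ i, F i := by
  refine Finset.sum_of_injOn (Fin.castLE hnN) ?_ ?_ ?_ ?_
  · intro a _ b _ h
    exact Fin.castLE_injective hnN h
  · intro a _; simp
  · intro i _ hi
    apply hF
    intro h
    exact hi ⟨⟨i, h⟩, by simp, by ext; simp⟩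
  · intro i _; rfl

open Filter Topology in
lemma case_zero {n : ℕ} (hnN : n ≤ N) (r : Finset (Fin N) → Fin N → ℝ)
    (hdiag : ∀ i : Fin N, r {i} i = 0)
    (hIstar : normalPlayers r = {i : Fin N | (i : ℕ) < n})
    (q : Fin N → ℝ) (hq : ∀ i : Fin N, ¬ (i : ℕ) < n → 0 < q i)
    (U : Ultrafilter ℕ) (y : ℕ → Fin N → ℝ)
    (hy01 : ∀ k i, 0 ≤ y k i ∧ y k i ≤ 1)
    (hy : Tendsto y U (𝓝 0))
    (lam : ℕ → ℝ) (hlam : ∀ k, 0 < lam k)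
    (hg1 : ∀ k i, 0 < y k i → 0 ≤ gG r q (lam k) (y k) i)
    (hg2 : ∀ k i, y k i < 1 → gG r q (lam k) (y k) i ≤ 0) :
    ∃ (w : Fin n → ℝ) (z : Fin (n + 1) → ℝ),
      IsLCPSolution n (fun i j => r {Fin.castLE hnN i} (Fin.castLE hnN j))
        (fun i => q (Fin.castLE hnN i)) w z := by
  have hnorm : ∀ i, (∀ l, i ∈ normalLevel r l) ↔ (i : ℕ) < n := by
    intro i
    have : i ∈ normalPlayers r ↔ i ∈ {i : Fin N | (i : ℕ) < n} := by rw [hIstar]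
    simpa [normalPlayers] using this
  have hlev : ∀ l i, i ∉ normalLevel r l → ∀ᶠ k in (U : Filter ℕ), y k i = 0 := by
    intro l
    induction l with
    | zero => intro i hi; exact absurd (by simp [normalLevel]) hi
    | succ l ih =>
      intro i hi
      by_cases hil : i ∈ normalLevel r l
      · refine abnormal_zero r hdiag q U y 0 i hy01 hy (fun j _ => rfl) lam hlam
          (fun k => hg1 k i) (hq i ?_) ?_
        · intro h
          exact hi ((hnorm i).2 h (l + 1))
        · intro j hj
          by_cases hjl : j ∈ normalLevel r l
          · left
            by_contra hcon
            push Not at hcon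
            exact hi ⟨hil, j, hjl, hj, hcon⟩
          · right; exact ih j hjl
      · exact ih i hil
  have habn : ∀ i : Fin N, ¬ (i : ℕ) < n → ∀ᶠ k in (U : Filter ℕ), y k i = 0 := by
    intro i hi
    rw [← hnorm] at hi
    push Not at hi
    obtain ⟨l, hl⟩ := hi
    exact hlev l i hl
  let σ : ℕ → ℝ := fun k => lam k + ∑ j, y k j
  have hsn : ∀ k, 0 ≤ ∑ j, y k j := fun k => Finset.sum_nonneg fun j _ => (hy01 k j).1
  have hσ : ∀ k, 0 < σ k := fun k => add_pos_of_pos_of_nonneg (hlam k) (hsn k)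
  obtain ⟨z0, hz0n, hz0⟩ := ultra_lim U (fun k => lam k / σ k) (fun k =>
    ⟨div_nonneg (hlam k).le (hσ k).le, (div_le_one (hσ k)).2 (by linarith [hsn k])⟩)
  have hzex : ∀ j, ∃ z, 0 ≤ z ∧ Tendsto (fun k => y k j / σ k) U (𝓝 z) := by
    intro j
    exact ultra_lim U (fun k => y k j / σ k) (fun k =>
        ⟨div_nonneg (hy01 k j).1 (hσ k).le, (div_le_one (hσ k)).2 (by
          have := Finset.single_le_sum (f := fun j => y k j) (s := Finset.univ)
            (fun j _ => (hy01 k j).1) (Finset.mem_univ j)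
          have h2 := hlam k
          simp only [σ] at this ⊢
          linarith)⟩)
  choose z hzn hz using hzex
  have hsum : z0 + ∑ j, z j = 1 := by
    have h1 : Tendsto (fun k => lam k / σ k + ∑ j, y k j / σ k) U (𝓝 (z0 + ∑ j, z j)) :=
      hz0.add (tendsto_finsetSum _ fun j hj => hz j)
    have h2 : (fun k => lam k / σ k + ∑ j, y k j / σ k) = fun _ => 1 := by
      funext k
      rw [← Finset.sum_div, ← add_div]
      exact div_self (hσ k).ne'
    rw [h2] at h1
    exact tendsto_nhds_unique h1 tendsto_const_nhds
  have hzab : ∀ i : Fin N, ¬ (i : ℕ) < n → z i = 0 := by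
    intro i hi
    refine tendsto_nhds_unique (hz i) ?_
    refine tendsto_const_nhds.congr' ?_
    filter_upwards [habn i hi] with k hk
    rw [hk, zero_div]
  have hlim := fun i => gG_div_tendsto r hdiag q U y 0 i hy (fun j _ => rfl) lam σ z0 z hz0
    (fun j _ => hz j)
  have hfull : ∀ i, z0 * q i + ∑ j ∈ Finset.univ.erase i, z j * r {j} i =
      z0 * q i + ∑ j, z j * r {j} i := by
    intro i
    rw [Finset.sum_erase _ (by rw [hdiag, mul_zero])]
  have hylim : ∀ i, Tendsto (fun k => y k i) U (𝓝 0) := fun i =>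
    ((continuous_apply i).tendsto (0 : Fin N → ℝ)).comp hy
  have hw0 : ∀ i, 0 ≤ z0 * q i + ∑ j, z j * r {j} i := by
    intro i
    have h1 := hlim i
    rw [hfull i] at h1
    have h2 : -(z0 * q i + ∑ j, z j * r {j} i) ≤ 0 := by
      refine le_of_tendsto h1 ?_
      filter_upwards [(hylim i).eventually_lt_const zero_lt_one] with k hk
      exact div_nonpos_of_nonpos_of_nonneg (hg2 k i hk) (hσ k).le
    linarith
  have hw1 : ∀ i, z i = 0 ∨ z0 * q i + ∑ j, z j * r {j} i = 0 := by
    intro i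
    rcases (hzn i).eq_or_lt with h0 | h0
    · exact Or.inl h0.symm
    · right
      have h1 := hlim i
      rw [hfull i] at h1
      have h2 : 0 ≤ -(z0 * q i + ∑ j, z j * r {j} i) := by
        refine ge_of_tendsto h1 ?_
        filter_upwards [(hz i).eventually_const_lt h0] with k hk
        have : 0 < y k i := by
          rcases (hy01 k i).1.eq_or_lt with h | h
          · rw [← h, zero_div] at hk; exact absurd hk (lt_irrefl _)
          · exact h
        exact div_nonneg (hg1 k i this) (hσ k).le
      linarith [hw0 i]
  refine ⟨fun i => z0 * q (Fin.castLE hnN i) + ∑ j, z j * r {j} (Fin.castLE hnN i),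
    Fin.cons z0 fun i => z (Fin.castLE hnN i), fun i => hw0 _, ?_, ?_, ?_, ?_⟩
  · intro i
    refine Fin.cases ?_ ?_ i
    · simpa using hz0n
    · intro j; simpa using hzn _
  · rw [Fin.sum_univ_succ]
    simp only [Fin.cons_zero, Fin.cons_succ]
    rw [sum_castLE hnN z hzab]
    exact hsum
  · intro j
    simp only [Fin.cons_zero, Fin.cons_succ]
    rw [sum_castLE hnN (fun i => z i * r {i} (Fin.castLE hnN j)) (fun i hi => by
      rw [hzab i hi, zero_mul])]
  · intro i
    simpa using hw1 (Fin.castLE hnN i)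

end Game

/-- **If the set of normal players is nonempty (ordered to be `{0,…,n-1}`), the problem
`LCP(R̂,0)` has no nontrivial solution, and `R̂` is not a `Q`-matrix, then the quitting
game has a stationary `ε`-equilibrium for every `ε > 0`.** -/
theorem quitting_game_stationary_equilibrium_of_not_QMatrix
    (N n : ℕ) (hN : 1 ≤ N) (hn : 1 ≤ n) (hnN : n ≤ N)
    (r : Finset (Fin N) → Fin N → ℝ)
    (hr : ∀ S i, r S i ∈ Set.Icc (-1 : ℝ) 1)
    (hdiag : ∀ i : Fin N, r {i} i = 0)
    (hIstar : normalPlayers r = {i : Fin N | (i : ℕ) < n})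
    (hNT : ¬ ∃ (w : Fin n → ℝ) (z : Fin (n + 1) → ℝ),
        IsLCPSolution n (fun i j => r {Fin.castLE hnN i} (Fin.castLE hnN j)) 0 w z ∧
          z 0 < 1)
    (hQ : ¬ IsQMatrix n (fun i j => r {Fin.castLE hnN i} (Fin.castLE hnN j)))
    (ε : ℝ) (hε : 0 < ε) :
    ∃ x : Fin N → ℕ → ℝ, (∀ i t, x i t = x i 0) ∧ IsEpsEquilibrium r x ε := by
  classical
  have hQ' : ∃ q : Fin n → ℝ, ¬ ∃ (w : Fin n → ℝ) (z : Fin (n + 1) → ℝ),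
      IsLCPSolution n (fun i j => r {Fin.castLE hnN i} (Fin.castLE hnN j)) q w z := by
    by_contra hcon
    push Not at hcon
    exact hQ hcon
  obtain ⟨q0, hq0⟩ := hQ'
  obtain ⟨q, hqn, hqa⟩ : ∃ q : Fin N → ℝ, (fun i : Fin n => q (Fin.castLE hnN i)) = q0 ∧
      ∀ i : Fin N, ¬ (i : ℕ) < n → 0 < q i := by
    refine ⟨fun i => if h : (i : ℕ) < n then q0 ⟨i, h⟩ else 1, ?_, ?_⟩
    · funext i; simp
    · intro i hi; simp [hi]
  obtain ⟨lam, hlam, hlam0⟩ : ∃ lam : ℕ → ℝ, (∀ k, 0 < lam k) ∧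
      Filter.Tendsto lam Filter.atTop (nhds 0) :=
    ⟨fun k => 1 / ((k : ℝ) + 1), fun k => by positivity, tendsto_one_div_add_atTop_nhds_zero_nat⟩
  have hex : ∀ k, ∃ y : Fin N → ℝ, (∀ i, 0 ≤ y i ∧ y i ≤ 1) ∧
      ∀ i, (0 < y i → 0 ≤ gG r q (lam k) y i) ∧ (y i < 1 → gG r q (lam k) y i ≤ 0) := fun k =>
    cube_vi N hN (gG r q (lam k)) (continuous_pi fun i =>
      (continuous_gG r q i).comp (continuous_const.prodMk continuous_id))
  choose y hy01 hyg using hex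
  obtain ⟨U, hU⟩ : ∃ U : Ultrafilter ℕ, (U : Filter ℕ) ≤ Filter.atTop :=
    ⟨Ultrafilter.of Filter.atTop, Ultrafilter.of_le _⟩
  obtain ⟨Y, hYmem, hYle⟩ := (isCompact_Icc (a := (0 : Fin N → ℝ)) (b := 1)).ultrafilter_le_nhds
    (U.map y) (by
      rw [Filter.le_principal_iff, Ultrafilter.coe_map, Filter.mem_map]
      exact Filter.Eventually.of_forall fun k =>
        ⟨fun i => (hy01 k i).1, fun i => (hy01 k i).2⟩)
  have hyY : Filter.Tendsto y U (nhds Y) := hYle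
  have hY01 : ∀ i, 0 ≤ Y i ∧ Y i ≤ 1 := fun i => ⟨hYmem.1 i, hYmem.2 i⟩
  have hyi : ∀ i, Filter.Tendsto (fun k => y k i) U (nhds (Y i)) := fun i =>
    ((continuous_apply i).tendsto Y).comp hyY
  have hglim : ∀ i, Filter.Tendsto (fun k => gG r q (lam k) (y k) i) U (nhds (gG r q 0 Y i)) :=
    fun i => gG_tendsto r q i U lam y Y (hlam0.mono_left hU) hyY
  have hg1 : ∀ i, 0 < Y i → 0 ≤ gG r q 0 Y i := by
    intro i hi
    refine ge_of_tendsto (hglim i) ?_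
    filter_upwards [(hyi i).eventually_const_lt hi] with k hk using (hyg k i).1 hk
  have hg2 : ∀ i, Y i < 1 → gG r q 0 Y i ≤ 0 := by
    intro i hi
    refine le_of_tendsto (hglim i) ?_
    filter_upwards [(hyi i).eventually_lt_const hi] with k hk using (hyg k i).2 hk
  by_cases h0 : ∃ i, 0 < Y i
  · obtain ⟨i, hi⟩ := h0
    by_cases h1 : ∃ j, j ≠ i ∧ 0 < Y j
    · obtain ⟨j, hji, hj⟩ := h1
      exact case_two r q Y hY01 j i hji hj hi hg1 hg2 ε hε
    · push Not at h1
      have hsolo : ∀ k, k ≠ i → Y k = 0 := fun k hk => le_antisymm (h1 k hk) (hY01 k).1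
      by_cases h2 : ∃ j, j ≠ i ∧ r {j} i ≤ 0
      · obtain ⟨j, hji, hj⟩ := h2
        exact case_one r hdiag q Y hY01 i j hji hi hsolo hj hg2 ε hε
      · exfalso
        push Not at h2
        have hin : ¬ (i : ℕ) < n := by
          intro h
          have h3 : i ∈ normalPlayers r := by rw [hIstar]; exact h
          have h4 : i ∈ normalLevel r 1 := Set.mem_iInter.1 h3 1
          obtain ⟨-, j, -, hji, hj⟩ := h4
          exact absurd hj (not_le.2 (h2 j hji))
        have h3 := abnormal_zero r hdiag q U y Y i hy01 hyY hsolo lam hlam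
          (fun k => (hyg k i).1) (hqa i hin) (fun j hj => Or.inl (h2 j hj))
        obtain ⟨k, hk1, hk2⟩ := (h3.and ((hyi i).eventually_const_lt hi)).exists
        linarith
  · exfalso
    push Not at h0
    have hYz : Y = 0 := funext fun i => le_antisymm (h0 i) (hY01 i).1
    rw [hYz] at hyY
    have := case_zero hnN r hdiag hIstar q hqa U y hy01 hyY lam hlam
      (fun k i => (hyg k i).1) (fun k i => (hyg k i).2)
    rw [hqn] at this
    exact hq0 this

end
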